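/- arXiv:1704.05164 — 2 statements merged into one kernel-verified Lean document; each statement's English description precedes it below -/
import Mathlib

section
/- Let n ≥ 2 and let V = {y ∈ ℝⁿ : |y| < 1, yₙ > 0}. If h : V → ℝ is a nonnegative harmonic function that is positively homogeneous of degree one, i.e. h(ρy) = ρh(y) for all ρ ∈ (0,1) and y ∈ V, then h has zero trace on the disk L = {y : |y| < 1, yₙ = 0}, i.e. h(y) → 0 as y → z for H^{n−1}-a.e. z ∈ L in the trace sense. -/
open MeasureTheory Metric Set Filter Topology

/-- Harmonic on a set: `C²` there with vanishing Laplacian. -/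
def HarmonicOn {d : ℕ} (u : EuclideanSpace ℝ (Fin d) → ℝ)
    (s : Set (EuclideanSpace ℝ (Fin d))) : Prop :=
  ContDiffOn ℝ 2 u s ∧ ∀ x ∈ s,
    (∑ i : Fin d, fderiv ℝ (fun y => fderiv ℝ u y (EuclideanSpace.single i 1)) x
      (EuclideanSpace.single i 1)) = 0

/-- The open upper unit half-ball in `ℝ^(n+2)`. -/
def upperHalfBall (n : ℕ) : Set (EuclideanSpace ℝ (Fin (n + 2))) :=
  {y | ‖y‖ < 1 ∧ 0 < y (Fin.last (n + 1))}

/-- The flat part of the boundary of the upper half-ball. -/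
def flatDisk (n : ℕ) : Set (EuclideanSpace ℝ (Fin (n + 2))) :=
  {y | ‖y‖ < 1 ∧ y (Fin.last (n + 1)) = 0}


lemma IsLocalMin.nonneg_of_hasDerivAt_hasDerivAt {φ φ' : ℝ → ℝ} {a c : ℝ}
    (hmin : IsLocalMin φ a) (h1 : ∀ᶠ t in 𝓝 a, HasDerivAt φ (φ' t) t)
    (h2 : HasDerivAt φ' c a) : 0 ≤ c := by
  by_contra! hc
  have hd : deriv φ =ᶠ[𝓝 a] φ' := h1.mono fun t ht => ht.deriv
  have hmax : IsLocalMax φ a := by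
    refine isLocalMax_of_deriv_deriv_neg ?_ hmin.deriv_eq_zero h1.self_of_nhds.continuousAt
    rwa [hd.deriv_eq, h2.deriv]
  have hconst : φ =ᶠ[𝓝 a] fun _ => φ a := by
    filter_upwards [hmin, hmax] with t h h' using le_antisymm h' h
  have h0 : φ' =ᶠ[𝓝 a] fun _ => (0 : ℝ) := by
    filter_upwards [hd, hconst.eventuallyEq_nhds] with t ht ht'
    rw [← ht, ht'.deriv_eq, deriv_const]
  have := h2.deriv
  rw [h0.deriv_eq, deriv_const] at this
  exact hc.ne this.symm

/-- If `u` has vanishing Laplacian at `x` and `u + v` has a local minimum there, then the Laplacian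
of `v` at `x`, computed along coordinate lines, is nonnegative. -/
lemma sum_nonneg_of_isLocalMin_add {d : ℕ} {u v : EuclideanSpace ℝ (Fin d) → ℝ}
    {x : EuclideanSpace ℝ (Fin d)} (hu : ContDiffAt ℝ 2 u x)
    (hlap : (∑ i : Fin d, fderiv ℝ (fun y => fderiv ℝ u y (EuclideanSpace.single i 1)) x
      (EuclideanSpace.single i 1)) = 0)
    (hmin : IsLocalMin (fun y => u y + v y) x) {v' : Fin d → ℝ → ℝ} {v'' : Fin d → ℝ}
    (h1 : ∀ i, ∀ᶠ t in 𝓝 (0 : ℝ),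
      HasDerivAt (fun t : ℝ => v (x + t • EuclideanSpace.single i 1)) (v' i t) t)
    (h2 : ∀ i, HasDerivAt (v' i) (v'' i) 0) : 0 ≤ ∑ i, v'' i := by
  have key : ∀ i, 0 ≤ fderiv ℝ (fun y => fderiv ℝ u y (EuclideanSpace.single i 1)) x
      (EuclideanSpace.single i 1) + v'' i := by
    intro i
    set e : EuclideanSpace ℝ (Fin d) := EuclideanSpace.single i 1
    have hline : ∀ t : ℝ, HasDerivAt (fun t : ℝ => x + t • e) e t := fun t => by
      simpa using ((hasDerivAt_id t).smul_const e).const_add x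
    have htend : Tendsto (fun t : ℝ => x + t • e) (𝓝 0) (𝓝 x) := by
      simpa using (hline 0).continuousAt.tendsto
    have hmin' : IsLocalMin (fun t : ℝ => u (x + t • e) + v (x + t • e)) 0 := by
      have := htend.eventually hmin
      simpa [IsLocalMin, IsMinFilter] using this
    refine hmin'.nonneg_of_hasDerivAt_hasDerivAt
      (φ' := fun t => fderiv ℝ u (x + t • e) e + v' i t) ?_ ?_
    · filter_upwards [h1 i, htend.eventually (hu.eventually (by simp))] with t ht ht'
      exact ((ht'.differentiableAt (by simp)).hasFDerivAt.comp_hasDerivAt t (hline t)).add ht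
    · refine HasDerivAt.add ?_ (h2 i)
      have hd : DifferentiableAt ℝ (fun y => fderiv ℝ u y e) (x + (0 : ℝ) • e) := by
        have := (hu.fderiv_right (m := 1) (by norm_num)).differentiableAt (by simp)
        simpa using this.clm_apply (differentiableAt_const e)
      have := hd.hasFDerivAt.comp_hasDerivAt 0 (hline 0)
      rw [zero_smul, add_zero] at this
      exact this
  have := Finset.sum_nonneg fun i (_ : i ∈ Finset.univ) => key i
  rwa [Finset.sum_add_distrib, hlap, zero_add] at this

lemma norm_add_smul_single_sq {d : ℕ} (x : EuclideanSpace ℝ (Fin d)) (i : Fin d) (t : ℝ) :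
    ‖x + t • EuclideanSpace.single i (1 : ℝ)‖ ^ 2 = ‖x‖ ^ 2 + 2 * t * x i + t ^ 2 := by
  rw [norm_add_sq_real, inner_smul_right, EuclideanSpace.inner_single_right, norm_smul]
  simp
  ring

lemma hasDerivAt_add_mul_add_sq (a b t : ℝ) :
    HasDerivAt (fun t : ℝ => a + 2 * t * b + t ^ 2) (2 * b + 2 * t) t := by
  have h := ((((hasDerivAt_id' t).const_mul 2).mul_const b).const_add a).add
    (hasDerivAt_pow 2 t)
  exact h.congr_deriv (by simp)

lemma HarmonicOn.contDiffAt {d : ℕ} {u : EuclideanSpace ℝ (Fin d) → ℝ}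
    {s : Set (EuclideanSpace ℝ (Fin d))} (hu : HarmonicOn u s) (hs : IsOpen s)
    {x : EuclideanSpace ℝ (Fin d)} (hx : x ∈ s) : ContDiffAt ℝ 2 u x :=
  hu.1.contDiffAt (hs.mem_nhds hx)

lemma HarmonicOn.sub_clm {d : ℕ} {u : EuclideanSpace ℝ (Fin d) → ℝ}
    {s : Set (EuclideanSpace ℝ (Fin d))} (hu : HarmonicOn u s) (hs : IsOpen s)
    (L : EuclideanSpace ℝ (Fin d) →L[ℝ] ℝ) : HarmonicOn (fun y => u y - L y) s := by
  refine ⟨hu.1.sub L.contDiff.contDiffOn, fun x hx => ?_⟩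
  rw [← hu.2 x hx]
  refine Finset.sum_congr rfl fun i _ => ?_
  have : (fun y => fderiv ℝ (fun y => u y - L y) y (EuclideanSpace.single i 1)) =ᶠ[𝓝 x]
      fun y => fderiv ℝ u y (EuclideanSpace.single i 1) - L (EuclideanSpace.single i 1) := by
    filter_upwards [(hu.contDiffAt hs hx).eventually (by simp)] with y hy
    rw [fderiv_fun_sub (hy.differentiableAt (by simp)) L.differentiableAt]
    simp
  rw [this.fderiv_eq, fderiv_sub_const]

/-- A nonnegative harmonic function which is positive at the centre of a closed ball is positive in
the interior of the ball. -/
lemma HarmonicOn.pos_of_pos_center {d : ℕ} {u : EuclideanSpace ℝ (Fin d) → ℝ}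
    {s : Set (EuclideanSpace ℝ (Fin d))} (hu : HarmonicOn u s) (hs : IsOpen s)
    (hnonneg : ∀ y ∈ s, 0 ≤ u y) {x₀ : EuclideanSpace ℝ (Fin d)} {R : ℝ}
    (hball : closedBall x₀ R ⊆ s) (hpos : 0 < u x₀) {y : EuclideanSpace ℝ (Fin d)}
    (hy : y ∈ ball x₀ R) : 0 < u y := by
  have hR : 0 < R := pos_of_mem_ball hy
  have hx₀ : x₀ ∈ s := hball (mem_closedBall_self hR.le)
  have hcont : ContinuousOn u (closedBall x₀ R) := hu.1.continuousOn.mono hball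
  obtain ⟨r, hr, hlow⟩ : ∃ r > 0, ∀ z ∈ ball x₀ r, u x₀ / 2 < u z := by
    have := (hu.contDiffAt hs hx₀).continuousAt.eventually (lt_mem_nhds (half_lt_self hpos))
    exact Metric.eventually_nhds_iff_ball.1 this
  set α : ℝ := (d + 1) / r ^ 2 with hα
  have hα0 : 0 < α := by positivity
  set b : EuclideanSpace ℝ (Fin d) → ℝ := fun z => Real.exp (-α * ‖z - x₀‖ ^ 2) with hb
  set ε : ℝ := u x₀ / 2 with hε
  have hε0 : 0 < ε := half_pos hpos
  set k : ℝ := Real.exp (-α * R ^ 2) with hk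
  suffices hcmp : ∀ z ∈ closedBall x₀ R, 0 ≤ u z + -ε * (b z - k) by
    have h1 := hcmp y (ball_subset_closedBall hy)
    have h2 : k < b y := by
      refine Real.exp_lt_exp.2 ?_
      have : ‖y - x₀‖ < R := by simpa [dist_eq_norm] using hy
      have : ‖y - x₀‖ ^ 2 < R ^ 2 := by gcongr
      nlinarith
    nlinarith
  by_contra! hneg
  obtain ⟨z, hz, hzneg⟩ := hneg
  have hbc : Continuous b := by fun_prop
  obtain ⟨q, hq, hqmin⟩ := (isCompact_closedBall x₀ R).exists_isMinOn ⟨z, hz⟩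
    (hcont.add (f := u) (g := fun z => -ε * (b z - k)) (by fun_prop))
  have hqneg : u q + -ε * (b q - k) < 0 := (hqmin hz).trans_lt hzneg
  have hqs : q ∈ s := hball hq
  have hqr : r ≤ ‖q - x₀‖ := by
    by_contra! hlt
    have h1 := hlow q (by simpa [dist_eq_norm] using hlt)
    have h2 : b q ≤ 1 := Real.exp_le_one_iff.2 (by nlinarith [sq_nonneg ‖q - x₀‖])
    have h3 : 0 < k := Real.exp_pos _
    nlinarith
  have hqR : q ∈ ball x₀ R := by
    rw [mem_ball, dist_eq_norm]
    refine lt_of_le_of_ne (by simpa [dist_eq_norm] using hq) fun heq => ?_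
    have : b q = k := by simp only [hb, hk, heq]
    rw [this] at hqneg
    linarith [hnonneg q hqs]
  have hlm : IsLocalMin (fun z => u z + -ε * (b z - k)) q :=
    hqmin.isLocalMin (Filter.mem_of_superset (isOpen_ball.mem_nhds hqR) ball_subset_closedBall)
  set w := q - x₀ with hw
  have hline : ∀ (i : Fin d) (t : ℝ), b (q + t • EuclideanSpace.single i 1) =
      Real.exp (-α * (‖w‖ ^ 2 + 2 * t * w i + t ^ 2)) := by
    intro i t
    simp only [hb]
    rw [← norm_add_smul_single_sq, hw]
    congr 4
    abel
  have hpoly : ∀ (i : Fin d) (t : ℝ), HasDerivAt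
      (fun t : ℝ => Real.exp (-α * (‖w‖ ^ 2 + 2 * t * w i + t ^ 2)))
      (Real.exp (-α * (‖w‖ ^ 2 + 2 * t * w i + t ^ 2)) * (-α * (2 * w i + 2 * t))) t := by
    intro i t
    exact ((hasDerivAt_add_mul_add_sq (‖w‖ ^ 2) (w i) t).const_mul (-α)).exp
  have hsum := sum_nonneg_of_isLocalMin_add (hu.contDiffAt hs hqs) (hu.2 q hqs) hlm
    (v' := fun i t => -ε * (Real.exp (-α * (‖w‖ ^ 2 + 2 * t * w i + t ^ 2)) *
      (-α * (2 * w i + 2 * t))))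
    (v'' := fun i => -ε * Real.exp (-α * ‖w‖ ^ 2) * (4 * α ^ 2 * w i ^ 2 - 2 * α)) ?_ ?_
  · rw [← Finset.mul_sum, Finset.sum_sub_distrib, ← Finset.mul_sum,
      ← EuclideanSpace.real_norm_sq_eq] at hsum
    simp only [Finset.sum_const, Finset.card_univ, Fintype.card_fin, nsmul_eq_mul] at hsum
    have h1 : r ^ 2 ≤ ‖w‖ ^ 2 := by gcongr
    have h2 : α * r ^ 2 = d + 1 := by rw [hα]; field_simp
    have h3 : (d : ℝ) + 1 ≤ α * ‖w‖ ^ 2 := by rw [← h2]; gcongr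
    have h4 : 0 < 4 * α ^ 2 * ‖w‖ ^ 2 - d * (2 * α) := by
      have : (0 : ℝ) ≤ d := by positivity
      nlinarith
    have h5 : 0 < ε * Real.exp (-α * ‖w‖ ^ 2) := by positivity
    nlinarith [mul_pos h5 h4]
  · intro i
    refine Eventually.of_forall fun t => ?_
    simp only [hline]
    exact ((hpoly i t).sub_const k).const_mul (-ε)
  · intro i
    have h1 : HasDerivAt (fun t : ℝ => -α * (2 * w i + 2 * t)) (-α * 2) 0 := by
      simpa using (((hasDerivAt_id (0 : ℝ)).const_mul 2).const_add (2 * w i)).const_mul (-α)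
    refine (((hpoly i 0).mul h1).const_mul (-ε)).congr_deriv ?_
    simp only [mul_zero, zero_mul, add_zero, ne_eq, OfNat.ofNat_ne_zero, not_false_eq_true, zero_pow]
    ring

/-- The strong minimum principle. -/
lemma HarmonicOn.eq_zero_of_nonneg {d : ℕ} {u : EuclideanSpace ℝ (Fin d) → ℝ}
    {s : Set (EuclideanSpace ℝ (Fin d))} (hu : HarmonicOn u s) (hs : IsOpen s)
    (hconn : IsPreconnected s) (hnonneg : ∀ y ∈ s, 0 ≤ u y) {p : EuclideanSpace ℝ (Fin d)}
    (hp : p ∈ s) (hup : u p = 0) : ∀ y ∈ s, u y = 0 := by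
  by_contra! hne
  obtain ⟨y, hy, hy0⟩ := hne
  have hopen : IsOpen (s ∩ u ⁻¹' Ioi 0) := hu.1.continuousOn.isOpen_inter_preimage hs isOpen_Ioi
  have hsub : s ⊆ s ∩ u ⁻¹' Ioi 0 := by
    refine hconn.subset_of_closure_inter_subset hopen
      ⟨y, hy, hy, (hnonneg y hy).lt_of_ne' hy0⟩ ?_
    rintro x ⟨hxc, hxs⟩
    obtain ⟨R, hR, hRs⟩ := Metric.isOpen_iff.1 hs x hxs
    obtain ⟨x', ⟨-, hx'⟩, hd⟩ := Metric.mem_closure_iff.1 hxc (R / 3) (by positivity)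
    refine ⟨hxs, hu.pos_of_pos_center hs hnonneg (R := R / 3) ?_ hx' hd⟩
    intro z hz
    refine hRs ?_
    rw [mem_ball]
    have := dist_triangle z x' x
    rw [mem_closedBall] at hz
    rw [dist_comm] at hd
    linarith
  exact (hsub hp).2.ne' hup

lemma isOpen_upperHalfBall (n : ℕ) : IsOpen (upperHalfBall n) := by
  have h1 : IsOpen {y : EuclideanSpace ℝ (Fin (n + 2)) | ‖y‖ < 1} :=
    isOpen_lt continuous_norm continuous_const
  have h2 : IsOpen {y : EuclideanSpace ℝ (Fin (n + 2)) | 0 < y (Fin.last (n + 1))} :=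
    isOpen_lt continuous_const (by fun_prop)
  exact h1.inter h2

lemma convex_upperHalfBall (n : ℕ) : Convex ℝ (upperHalfBall n) := by
  have h1 : upperHalfBall n = ball 0 1 ∩
      (EuclideanSpace.proj (𝕜 := ℝ) (Fin.last (n + 1))) ⁻¹' Ioi 0 := by
    ext y
    simp [upperHalfBall]
  rw [h1]
  exact (convex_ball _ _).inter ((convex_Ioi 0).linear_preimage _)

/-- At a point `q` of the sphere of radius `1 / 2` close to the equator, the function
`y ↦ yₙ * (ε * (log ‖y‖² - 2 * log yₙ) - m)` is strictly superharmonic, so that its sum with a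
harmonic function has no local minimum. -/
lemma not_isLocalMin_add_log_barrier {n : ℕ} {u : EuclideanSpace ℝ (Fin (n + 2)) → ℝ}
    {q : EuclideanSpace ℝ (Fin (n + 2))} (hu : ContDiffAt ℝ 2 u q)
    (hlap : (∑ i : Fin (n + 2), fderiv ℝ (fun y => fderiv ℝ u y (EuclideanSpace.single i 1)) q
      (EuclideanSpace.single i 1)) = 0)
    {ε : ℝ} (hε : 0 < ε) (m : ℝ) (hq : 0 < q (Fin.last (n + 1)))
    (hsmall : (n + 2) * q (Fin.last (n + 1)) ^ 2 < ‖q‖ ^ 2) :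
    ¬ IsLocalMin (fun y => u y + y (Fin.last (n + 1)) *
      (ε * (Real.log (‖y‖ ^ 2) - 2 * Real.log (y (Fin.last (n + 1)))) - m)) q := by
  intro hlm
  set l := Fin.last (n + 1) with hl
  set s := q l with hs
  set r := ‖q‖ ^ 2 with hr
  have hr0 : 0 < r := lt_of_le_of_lt (by positivity) hsmall
  set δ : Fin (n + 2) → ℝ := fun i => if i = l then 1 else 0 with hδ
  have hcoord : ∀ (i : Fin (n + 2)) (t : ℝ),
      (q + t • EuclideanSpace.single i (1 : ℝ)) l = s + δ i * t := by
    intro i t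
    simp only [PiLp.add_apply, PiLp.smul_apply, PiLp.single_apply, smul_eq_mul, hs, hδ,
      eq_comm (a := l), mul_comm]
  have hlin : ∀ (i : Fin (n + 2)) (t : ℝ), HasDerivAt (fun t : ℝ => s + δ i * t) (δ i) t :=
    fun i t => by simpa using ((hasDerivAt_id t).const_mul (δ i)).const_add s
  have hquad : ∀ (i : Fin (n + 2)) (t : ℝ), HasDerivAt (fun t : ℝ => r + 2 * t * q i + t ^ 2)
      (2 * q i + 2 * t) t := fun i t => hasDerivAt_add_mul_add_sq r (q i) t
  have hsum := sum_nonneg_of_isLocalMin_add hu hlap hlm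
    (v' := fun i t => δ i * (ε * (Real.log (r + 2 * t * q i + t ^ 2) -
        2 * Real.log (s + δ i * t)) - m) +
      ε * ((s + δ i * t) * ((2 * q i + 2 * t) / (r + 2 * t * q i + t ^ 2)) - 2 * δ i))
    (v'' := fun i => ε * (4 * δ i * q i / r + 2 * s / r - 4 * s / r ^ 2 * q i ^ 2 - 2 / s * δ i))
    ?_ ?_
  · have h1 : ∑ i, δ i = 1 := by simp [hδ]
    have h2 : ∑ i, 4 * δ i * q i / r = 4 * s / r := by
      simp [hδ, hs, ite_mul, ← Finset.sum_div]
    have h3 : ∑ i, q i ^ 2 = r := by rw [hr, EuclideanSpace.real_norm_sq_eq]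
    rw [← Finset.mul_sum, Finset.sum_sub_distrib, Finset.sum_sub_distrib, Finset.sum_add_distrib,
      h2, ← Finset.mul_sum, ← Finset.mul_sum, h1, h3] at hsum
    simp only [Finset.sum_const, Finset.card_univ, Fintype.card_fin, nsmul_eq_mul] at hsum
    have h4 : 4 * s / r + ((n + 2 : ℕ) : ℝ) * (2 * s / r) - 4 * s / r ^ 2 * r - 2 / s * 1 =
        2 * ((n + 2) * s ^ 2 - r) / (r * s) := by
      push_cast
      field_simp
      ring
    rw [h4] at hsum
    have h5 : 2 * ((n + 2) * s ^ 2 - r) / (r * s) < 0 :=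
      div_neg_of_neg_of_pos (by linarith) (by positivity)
    nlinarith
  · intro i
    have e1 : ∀ᶠ t in 𝓝 (0 : ℝ), 0 < s + δ i * t :=
      (hlin i 0).continuousAt.eventually (lt_mem_nhds (by simpa using hq))
    have e2 : ∀ᶠ t in 𝓝 (0 : ℝ), 0 < r + 2 * t * q i + t ^ 2 :=
      (hquad i 0).continuousAt.eventually (lt_mem_nhds (by simpa using hr0))
    filter_upwards [e1, e2] with t h1 h2
    simp only [hcoord, norm_add_smul_single_sq]
    refine ((hlin i t).mul (((((hquad i t).log h2.ne').sub
      (((hlin i t).log h1.ne').const_mul 2)).const_mul ε).sub_const m)).congr_deriv ?_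
    simp only [Pi.sub_apply]
    field_simp
  · intro i
    have hq' : s + δ i * 0 ≠ 0 := by simpa using hq.ne'
    have hr' : r + 2 * 0 * q i + 0 ^ 2 ≠ 0 := by simpa using hr0.ne'
    have h1 : HasDerivAt (fun t : ℝ => 2 * q i + 2 * t) 2 0 := by
      simpa using ((hasDerivAt_id (0 : ℝ)).const_mul 2).const_add (2 * q i)
    have hδδ : δ i * δ i = δ i := by simp [hδ]
    refine ((((((hquad i 0).log hr').sub
      (((hlin i 0).log hq').const_mul 2)).const_mul ε).sub_const m).const_mul (δ i) |>.add
      ((((hlin i 0).mul (h1.div (hquad i 0) hr')).sub_const (2 * δ i)).const_mul ε)).congr_deriv ?_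
    simp only [Pi.div_apply, mul_zero, zero_mul, add_zero, ne_eq, OfNat.ofNat_ne_zero,
      not_false_eq_true, zero_pow]
    field_simp
    linear_combination (-2 * r ^ 2) * hδδ

section HomogeneousDegreeOne

variable {n : ℕ} {h : EuclideanSpace ℝ (Fin (n + 2)) → ℝ}

lemma smul_mem_upperHalfBall {y : EuclideanSpace ℝ (Fin (n + 2))} (hy : y ∈ upperHalfBall n) :
    (2 * ‖y‖)⁻¹ • y ∈ upperHalfBall n ∧ ‖(2 * ‖y‖)⁻¹ • y‖ = 1 / 2 := by
  have hy0 : 0 < ‖y‖ := norm_pos_iff.2 fun h0 => by simpa [h0] using hy.2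
  have h1 : ‖(2 * ‖y‖)⁻¹ • y‖ = 1 / 2 := by
    rw [norm_smul, Real.norm_of_nonneg (by positivity)]
    field_simp
  refine ⟨⟨by rw [h1]; norm_num, ?_⟩, h1⟩
  have := hy.2
  simp only [PiLp.smul_apply, smul_eq_mul]
  positivity

lemma eq_two_mul_norm_mul_of_homogeneous
    (hhom : ∀ ρ ∈ Ioo (0 : ℝ) 1, ∀ y ∈ upperHalfBall n, h (ρ • y) = ρ * h y)
    {y : EuclideanSpace ℝ (Fin (n + 2))} (hy : y ∈ upperHalfBall n) :
    h y = 2 * ‖y‖ * h ((2 * ‖y‖)⁻¹ • y) := by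
  have hy0 : 0 < ‖y‖ := norm_pos_iff.2 fun h0 => by simpa [h0] using hy.2
  rcases lt_trichotomy (2 * ‖y‖) 1 with hlt | heq | hgt
  · rw [← hhom _ ⟨by positivity, hlt⟩ _ (smul_mem_upperHalfBall hy).1,
      smul_inv_smul₀ (by positivity)]
  · simp [heq]
  · rw [hhom _ ⟨by positivity, inv_lt_one_of_one_lt₀ hgt⟩ _ hy, mul_inv_cancel_left₀ (by positivity)]

lemma log_norm_sq_sub_log_smul {y : EuclideanSpace ℝ (Fin (n + 2))} (hy : y ∈ upperHalfBall n)
    {ρ : ℝ} (hρ : 0 < ρ) :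
    Real.log (‖ρ • y‖ ^ 2) - 2 * Real.log ((ρ • y) (Fin.last (n + 1))) =
      Real.log (‖y‖ ^ 2) - 2 * Real.log (y (Fin.last (n + 1))) := by
  have hy0 : 0 < ‖y‖ := norm_pos_iff.2 fun h0 => by simpa [h0] using hy.2
  rw [norm_smul, Real.norm_of_nonneg hρ.le, mul_pow, Real.log_mul (by positivity) (by positivity),
    PiLp.smul_apply, smul_eq_mul, Real.log_mul hρ.ne' hy.2.ne', Real.log_pow]
  push_cast
  ring

lemma log_norm_sq_sub_log_nonneg {y : EuclideanSpace ℝ (Fin (n + 2))} (hy : y ∈ upperHalfBall n) :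
    0 ≤ Real.log (‖y‖ ^ 2) - 2 * Real.log (y (Fin.last (n + 1))) := by
  have h1 : y (Fin.last (n + 1)) ≤ ‖y‖ :=
    (le_abs_self _).trans (by simpa using PiLp.norm_apply_le y (Fin.last (n + 1)))
  have := Real.log_le_log hy.2 h1
  rw [Real.log_pow]
  push_cast
  linarith

/-- If `h ≥ c yₙ` holds on the part of the sphere of radius `1 / 2` away from the equator, then it
holds on the whole half-sphere up to a logarithmic correction. -/
lemma le_add_log_barrier_of_homogeneous (hharm : HarmonicOn h (upperHalfBall n))
    (hnonneg : ∀ y ∈ upperHalfBall n, 0 ≤ h y)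
    (hhom : ∀ ρ ∈ Ioo (0 : ℝ) 1, ∀ y ∈ upperHalfBall n, h (ρ • y) = ρ * h y) {c : ℝ}
    (hc : ∀ y ∈ upperHalfBall n, ‖y‖ = 1 / 2 → 1 / 4 ≤ (n + 2) * y (Fin.last (n + 1)) ^ 2 →
      c ≤ h y / y (Fin.last (n + 1)))
    {ε : ℝ} (hε : 0 < ε) {y : EuclideanSpace ℝ (Fin (n + 2))} (hy : y ∈ upperHalfBall n)
    (hy2 : ‖y‖ = 1 / 2) :
    c ≤ h y / y (Fin.last (n + 1)) +
      ε * (Real.log (‖y‖ ^ 2) - 2 * Real.log (y (Fin.last (n + 1)))) := by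
  set l := Fin.last (n + 1) with hl
  set Φ : EuclideanSpace ℝ (Fin (n + 2)) → ℝ := fun y =>
    h y / y l + ε * (Real.log (‖y‖ ^ 2) - 2 * Real.log (y l)) with hΦ
  change c ≤ Φ y
  by_contra! hlt
  have hopen := isOpen_upperHalfBall n
  have hyl : 0 < y l := hy.2
  obtain ⟨η, hη0, hηy, hη⟩ : ∃ η > 0, η ≤ y l ∧
      c ≤ ε * (Real.log ((1 / 2) ^ 2) - 2 * Real.log η) := by
    refine ⟨min (y l) (Real.exp ((Real.log ((1 / 2) ^ 2) - c / ε) / 2)),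
      lt_min hyl (Real.exp_pos _), min_le_left _ _, ?_⟩
    have h1 := Real.log_le_log (lt_min hyl (Real.exp_pos _))
      (min_le_right (y l) (Real.exp ((Real.log ((1 / 2) ^ 2) - c / ε) / 2)))
    rw [Real.log_exp] at h1
    rw [← div_le_iff₀' hε]
    linarith
  set K : Set (EuclideanSpace ℝ (Fin (n + 2))) := sphere 0 (1 / 2) ∩ {y | η ≤ y l} with hK
  have hKc : IsCompact K := (isCompact_sphere _ _).inter_right
    (isClosed_le continuous_const (by fun_prop))
  have hKV : ∀ z ∈ K, z ∈ upperHalfBall n := by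
    rintro z ⟨hz, hz'⟩
    rw [mem_sphere_zero_iff_norm] at hz
    exact ⟨by rw [hz]; norm_num, hη0.trans_le hz'⟩
  have hcont : ContinuousOn Φ K := by
    have hl' : Continuous fun z : EuclideanSpace ℝ (Fin (n + 2)) => z l := by fun_prop
    refine ((hharm.1.continuousOn.mono hKV).div hl'.continuousOn
      fun z hz => (hKV z hz).2.ne').add (((ContinuousOn.log (by fun_prop) ?_).sub
        ((hl'.continuousOn.log fun z hz => (hKV z hz).2.ne').const_mul 2)).const_mul ε)
    intro z hz
    rw [mem_sphere_zero_iff_norm.1 hz.1]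
    norm_num
  obtain ⟨q, hqK, hqmin⟩ := hKc.exists_isMinOn ⟨y, by simpa using hy2, hηy⟩ hcont
  have hqc : Φ q < c := (hqmin ⟨by simpa using hy2, hηy⟩).trans_lt hlt
  have hqV := hKV q hqK
  have hq2 : ‖q‖ = 1 / 2 := by simpa using hqK.1
  have hmin : ∀ z ∈ upperHalfBall n, ‖z‖ = 1 / 2 → Φ q ≤ Φ z := by
    intro z hz hz2
    by_cases hzη : η ≤ z l
    · exact hqmin ⟨by simpa using hz2, hzη⟩
    · refine hqc.le.trans (hη.trans ?_)
      have h1 : Real.log (z l) ≤ Real.log η := Real.log_le_log hz.2 (not_le.1 hzη).le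
      have h2 : 0 ≤ h z / z l := div_nonneg (hnonneg z hz) hz.2.le
      simp only [hΦ, hz2]
      nlinarith
  have hmin' : ∀ z ∈ upperHalfBall n, Φ q ≤ Φ z := by
    intro z hz
    have hz0 : 0 < ‖z‖ := norm_pos_iff.2 fun h0 => by simpa [h0] using hz.2
    have hzl : 0 < z l := hz.2
    obtain ⟨h1, h2⟩ := smul_mem_upperHalfBall hz
    refine (hmin _ h1 h2).trans_eq ?_
    simp only [hΦ]
    rw [log_norm_sq_sub_log_smul hz (by positivity), eq_two_mul_norm_mul_of_homogeneous hhom hz,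
      PiLp.smul_apply, smul_eq_mul, ← hl]
    field_simp
  refine not_isLocalMin_add_log_barrier (hharm.contDiffAt hopen hqV) (hharm.2 q hqV) hε (Φ q)
    hqV.2 ?_ ?_
  · by_contra! hge
    have h1 := hc q hqV hq2 (by rw [hq2] at hge; linarith)
    have h2 := mul_nonneg hε.le (log_norm_sq_sub_log_nonneg hqV)
    simp only [hΦ] at hqc
    linarith
  · have hval : ∀ z ∈ upperHalfBall n, h z + z l * (ε * (Real.log (‖z‖ ^ 2) - 2 * Real.log (z l)) -
        Φ q) = z l * (Φ z - Φ q) := by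
      intro z hz
      have hzl : z l ≠ 0 := hz.2.ne'
      simp only [hΦ]
      field_simp
      ring
    filter_upwards [hopen.mem_nhds hqV] with z hz
    rw [hval z hz, hval q hqV, sub_self, mul_zero]
    exact mul_nonneg hz.2.le (sub_nonneg.2 (hmin' z hz))

/-- A nonnegative harmonic function on the upper half-ball which is positively homogeneous of
degree one is a multiple of the last coordinate. -/
theorem exists_eq_const_mul_last_of_homogeneous (hharm : HarmonicOn h (upperHalfBall n))
    (hnonneg : ∀ y ∈ upperHalfBall n, 0 ≤ h y)
    (hhom : ∀ ρ ∈ Ioo (0 : ℝ) 1, ∀ y ∈ upperHalfBall n, h (ρ • y) = ρ * h y) :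
    ∃ c : ℝ, ∀ y ∈ upperHalfBall n, h y = c * y (Fin.last (n + 1)) := by
  set l := Fin.last (n + 1) with hl
  have hopen := isOpen_upperHalfBall n
  have hlc : Continuous fun z : EuclideanSpace ℝ (Fin (n + 2)) => z l := by fun_prop
  set S : Set (EuclideanSpace ℝ (Fin (n + 2))) :=
    sphere 0 (1 / 2) ∩ ({y | 0 ≤ y l} ∩ {y | 1 / 4 ≤ (n + 2) * y l ^ 2}) with hS
  have hSc : IsCompact S := (isCompact_sphere _ _).inter_right
    ((isClosed_le continuous_const hlc).inter (isClosed_le continuous_const (by fun_prop)))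
  have hSV : ∀ z ∈ S, z ∈ upperHalfBall n := by
    rintro z ⟨hz, hz0, hz1⟩
    rw [mem_sphere_zero_iff_norm] at hz
    refine ⟨by rw [hz]; norm_num, lt_of_le_of_ne hz0 fun h0 => ?_⟩
    rw [mem_ofPred_eq, hl, ← h0] at hz1
    norm_num at hz1
  have hSne : S.Nonempty := by
    refine ⟨EuclideanSpace.single l (1 / 2), by simp, by simp, ?_⟩
    have : (0 : ℝ) ≤ n := by positivity
    simp only [mem_ofPred_eq, PiLp.single_apply, if_true]
    linarith
  obtain ⟨p, hpS, hpmin⟩ := hSc.exists_isMinOn hSne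
    ((hharm.1.continuousOn.mono hSV).div hlc.continuousOn fun z hz => (hSV z hz).2.ne')
  have hpV := hSV p hpS
  set c := h p / p l
  have hlow : ∀ y ∈ upperHalfBall n, ‖y‖ = 1 / 2 → c * y l ≤ h y := by
    intro y hy hy2
    rw [← le_div_iff₀ hy.2]
    have hG := log_norm_sq_sub_log_nonneg hy
    set G := Real.log (‖y‖ ^ 2) - 2 * Real.log (y l) with hGdef
    have hbar : ∀ ε > 0, c ≤ h y / y l + ε * G := fun ε hε =>
      le_add_log_barrier_of_homogeneous hharm hnonneg hhom
        (fun z hz hz2 hz3 => hpmin ⟨by simpa using hz2, hz.2.le, hz3⟩) hε hy hy2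
    refine le_of_forall_pos_le_add fun ε hε => (hbar (ε / (G + 1)) (by positivity)).trans ?_
    gcongr
    rw [div_mul_eq_mul_div, div_le_iff₀ (by positivity)]
    nlinarith
  have hlow' : ∀ y ∈ upperHalfBall n, 0 ≤ h y - (c • EuclideanSpace.proj (𝕜 := ℝ) l) y := by
    intro y hy
    have hy0 : 0 < ‖y‖ := norm_pos_iff.2 fun h0 => by simpa [h0] using hy.2
    obtain ⟨h1, h2⟩ := smul_mem_upperHalfBall hy
    have h3 := hlow _ h1 h2
    rw [PiLp.smul_apply, smul_eq_mul] at h3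
    have h4 := mul_le_mul_of_nonneg_left h3 (show 0 ≤ 2 * ‖y‖ by positivity)
    rw [← eq_two_mul_norm_mul_of_homogeneous hhom hy, mul_left_comm,
      mul_inv_cancel_left₀ (by positivity)] at h4
    simpa using h4
  refine ⟨c, fun y hy => ?_⟩
  have := (hharm.sub_clm hopen (c • EuclideanSpace.proj (𝕜 := ℝ) l)).eq_zero_of_nonneg hopen
    (convex_upperHalfBall n).isPreconnected hlow' hpV
    (by simp [c, div_mul_cancel₀ (h p) (show p l ≠ 0 from hpV.2.ne')]) y hy
  simpa [sub_eq_zero] using this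

end HomogeneousDegreeOne

/-- A nonnegative harmonic function on the upper half-ball which is positively homogeneous
of degree one has zero trace on the flat part of the boundary: `h(y) → 0` as `y → z` from
inside the half-ball, for `H^{n-1}`-a.e. point `z` of the flat disk. -/
theorem stmt_1 (n : ℕ) (h : EuclideanSpace ℝ (Fin (n + 2)) → ℝ)
    (hharm : HarmonicOn h (upperHalfBall n))
    (hnonneg : ∀ y ∈ upperHalfBall n, 0 ≤ h y)
    (hhom : ∀ ρ ∈ Ioo (0 : ℝ) 1, ∀ y ∈ upperHalfBall n, h (ρ • y) = ρ * h y) :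
    ∀ᵐ z ∂(μH[(n + 1 : ℝ)] : Measure (EuclideanSpace ℝ (Fin (n + 2)))),
      z ∈ flatDisk n → Tendsto h (𝓝[upperHalfBall n] z) (𝓝 0) := by
  obtain ⟨c, hc⟩ := exists_eq_const_mul_last_of_homogeneous hharm hnonneg hhom
  refine Eventually.of_forall fun z hz => ?_
  have hcont : Continuous fun y : EuclideanSpace ℝ (Fin (n + 2)) => c * y (Fin.last (n + 1)) := by
    fun_prop
  have hlim := (hcont.tendsto z).mono_left (nhdsWithin_le_nhds (s := upperHalfBall n))
  rw [hz.2, mul_zero] at hlim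
  exact hlim.congr' (eventually_nhdsWithin_of_forall fun y hy => (hc y hy).symm)
end

section
/- Let n ≥ 2 and let u be a C² solution of the minimal surface equation div(Du/√(1+|Du|²)) = 0 on an open set Ω ⊂ ℝⁿ containing a point y with dist(y, ∂Ω) ≥ ρ > 0. Suppose sup_Ω |u| ≤ K and sup_Ω |Du| ≤ Λ for constants K, Λ. Then there is a constant c depending only on n and Λ such that sup_{B_{ρ/2}(y)} |Du|² ≤ (c/ρ^{n+2}) ∫_{B_ρ(y)} u² dx. -/
open MeasureTheory Metric Set

section Calculus
variable {n : ℕ}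

local notation "E" => EuclideanSpace ℝ (Fin n)

/-- The partial derivative of `f` in the `i`-th coordinate direction. -/
noncomputable def partialDeriv (i : Fin n) (f : E → ℝ) (x : E) : ℝ :=
  fderiv ℝ f x (EuclideanSpace.single i 1)

lemma ContDiff.partialDeriv {f : E → ℝ} {m k : ℕ∞} (hf : ContDiff ℝ m f) (hk : k + 1 ≤ m)
    (i : Fin n) : ContDiff ℝ k (partialDeriv i f) :=
  (hf.fderiv_right (by exact_mod_cast hk)).clm_apply contDiff_const

lemma ContDiff.continuous_partialDeriv {f : E → ℝ} (hf : ContDiff ℝ 1 f) (i : Fin n) :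
    Continuous (_root_.partialDeriv i f) :=
  (hf.continuous_fderiv one_ne_zero).clm_apply continuous_const

lemma partialDeriv_mul {f g : E → ℝ} {x : E} (hf : DifferentiableAt ℝ f x)
    (hg : DifferentiableAt ℝ g x) (i : Fin n) :
    partialDeriv i (fun y => f y * g y) x =
      f x * partialDeriv i g x + partialDeriv i f x * g x := by
  simp [partialDeriv, fderiv_fun_mul hf hg, mul_comm]

lemma partialDeriv_coord (i j : Fin n) (x : E) :
    partialDeriv i (fun y : E => y j) x = if j = i then 1 else 0 := by
  have : HasFDerivAt (fun y : E => y j) (EuclideanSpace.proj j : E →L[ℝ] ℝ) x :=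
    (EuclideanSpace.proj j : E →L[ℝ] ℝ).hasFDerivAt
  simp [partialDeriv, this.fderiv]

lemma partialDeriv_comp {g : ℝ → ℝ} {g' : ℝ} {f : E → ℝ} {x : E} (hg : HasDerivAt g g' (f x))
    (hf : DifferentiableAt ℝ f x) (i : Fin n) :
    partialDeriv i (fun y => g (f y)) x = g' * partialDeriv i f x := by
  have := hg.comp_hasFDerivAt x hf.hasFDerivAt
  have h2 : fderiv ℝ (fun y => g (f y)) x = g' • fderiv ℝ f x := this.fderiv
  simp [partialDeriv, h2]

lemma partialDeriv_comm {f : E → ℝ} (hf : ContDiff ℝ 2 f) (i j : Fin n) (x : E) :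
    partialDeriv i (partialDeriv j f) x = partialDeriv j (partialDeriv i f) x := by
  have hd : DifferentiableAt ℝ (fderiv ℝ f) x :=
    ((hf.fderiv_right (m := 1) (by norm_num)).differentiable one_ne_zero) x
  have h : ∀ a b : Fin n, partialDeriv a (partialDeriv b f) x =
      fderiv ℝ (fderiv ℝ f) x (EuclideanSpace.single a 1) (EuclideanSpace.single b 1) := by
    intro a b
    unfold partialDeriv
    rw [fderiv_clm_apply hd (differentiableAt_const _)]
    simp
  rw [h, h]
  exact (hf.contDiffAt.isSymmSndFDerivAt (by simp)) _ _

lemma norm_sq_clm_eq_sum (L : E →L[ℝ] ℝ) :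
    ‖L‖ ^ 2 = ∑ i, L (EuclideanSpace.single i 1) ^ 2 := by
  rw [← (InnerProductSpace.toDual ℝ E).symm.norm_map L, EuclideanSpace.norm_sq_eq]
  refine Finset.sum_congr rfl fun i _ => ?_
  have := InnerProductSpace.toDual_symm_apply (𝕜 := ℝ) (x := EuclideanSpace.single i (1 : ℝ)) (y := L)
  rw [EuclideanSpace.inner_single_right] at this
  rw [← this]
  simp

lemma norm_fderiv_sq (f : E → ℝ) (x : E) : ‖fderiv ℝ f x‖ ^ 2 = ∑ i, partialDeriv i f x ^ 2 :=
  norm_sq_clm_eq_sum _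

lemma support_partialDeriv_subset (f : E → ℝ) (i : Fin n) :
    tsupport (partialDeriv i f) ⊆ tsupport f := by
  refine closure_minimal (fun x hx => ?_) (isClosed_tsupport f)
  by_contra h
  apply hx
  have : fderiv ℝ f x = 0 := by
    have := support_fderiv_subset ℝ (f := f)
    by_contra h'
    exact h (this h')
  simp [partialDeriv, this]

lemma HasCompactSupport.partialDeriv {f : E → ℝ} (hf : HasCompactSupport f) (i : Fin n) :
    HasCompactSupport (_root_.partialDeriv i f) :=
  hf.of_isClosed_subset (isClosed_tsupport _) (support_partialDeriv_subset f i)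

/-- The integral of a partial derivative of a compactly supported function vanishes. -/
lemma integral_partialDeriv_eq_zero {f : E → ℝ} (hf : ContDiff ℝ 1 f) (hc : HasCompactSupport f)
    (i : Fin n) : ∫ x, partialDeriv i f x = 0 := by
  have hi := (hf.continuous_partialDeriv i).integrable_of_hasCompactSupport (μ := volume)
    (hc.partialDeriv i)
  have h := integral_mul_fderiv_eq_neg_fderiv_mul_of_integrable (μ := (volume : Measure E))
    (f := fun _ : E => (1 : ℝ)) (g := f) (v := EuclideanSpace.single i 1) (by simp)
    (by simpa [partialDeriv] using! hi)
    (by simpa using hf.continuous.integrable_of_hasCompactSupport hc)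
    (fun x _ => differentiableAt_const _) (fun x _ => (hf.differentiable one_ne_zero) x)
  simpa [partialDeriv] using! h

/-- Differentiation of `∫ N(x + t v) g(x) dx` in `t`. -/
lemma hasDerivAt_integral_translate_mul {N g : E → ℝ} (hN : ContDiff ℝ 1 N) (hg : Continuous g)
    (hc : HasCompactSupport g) (v : E) :
    HasDerivAt (fun t : ℝ => ∫ x, N (x + t • v) * g x) (∫ x, fderiv ℝ N x v * g x) 0 := by
  have hcont : Continuous fun q : ℝ × E => fderiv ℝ N (q.2 + q.1 • v) v :=
    ((hN.continuous_fderiv one_ne_zero).comp (by fun_prop)).clm_apply continuous_const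
  obtain ⟨C, hC⟩ := ((isCompact_Icc (a := (-1 : ℝ)) (b := 1)).prod hc).exists_bound_of_continuousOn
    hcont.continuousOn
  have hNc := hN.continuous
  have key := hasDerivAt_integral_of_dominated_loc_of_deriv_le (μ := (volume : Measure E))
    (F := fun (t : ℝ) x => N (x + t • v) * g x)
    (F' := fun (t : ℝ) x => fderiv ℝ N (x + t • v) v * g x) (x₀ := 0) (s := Icc (-1 : ℝ) 1)
    (bound := fun x => C * ‖g x‖) (Icc_mem_nhds (by norm_num) (by norm_num))
    (Filter.Eventually.of_forall fun t => (Continuous.aestronglyMeasurable (by fun_prop)))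
    ((Continuous.integrable_of_hasCompactSupport (by fun_prop) hc.mul_left))
    ((Continuous.aestronglyMeasurable
      ((hcont.comp (by fun_prop : Continuous fun x : E => ((0 : ℝ), x))).mul hg)))
    (Filter.Eventually.of_forall fun x t ht => ?_)
    ((hg.norm.integrable_of_hasCompactSupport hc.norm).const_mul C)
    (Filter.Eventually.of_forall fun x t ht => ?_)
  · simpa using key.2
  · rw [norm_mul]
    by_cases hx : x ∈ tsupport g
    · exact mul_le_mul_of_nonneg_right (hC (t, x) ⟨ht, hx⟩) (norm_nonneg _)
    · simp [image_eq_zero_of_notMem_tsupport hx]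
  · refine HasDerivAt.mul_const ?_ _
    have h1 : HasDerivAt (fun t : ℝ => x + t • v) v t := by
      simpa using ((hasDerivAt_id t).smul_const v).const_add x
    exact ((hN.differentiable one_ne_zero) (x + t • v)).hasFDerivAt.comp_hasDerivAt t h1

end Calculus

section Algebra
variable {ι : Type*} [Fintype ι]

/-- The trace of the square of `(1 - ν νᵀ) H` is nonnegative for symmetric `H` and `|ν| ≤ 1`. -/
lemma sum_mul_swap_nonneg (ν b : ι → ℝ) (H : ι → ι → ℝ) (hH : ∀ i k, H i k = H k i)
    (hb : ∀ k, b k = ∑ j, ν j * H j k) (hν : ∑ i, ν i ^ 2 ≤ 1) :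
    0 ≤ ∑ i, ∑ k, (H i k - ν i * b k) * (H k i - ν k * b i) := by
  set τ := ∑ i, ν i ^ 2 with hτ
  set β := ∑ i, ν i * b i with hβ
  set B := ∑ i, b i ^ 2 with hB
  have s1 : ∑ i, ∑ k, H i k * ν i * b k = B := by
    rw [Finset.sum_comm, hB]
    refine Finset.sum_congr rfl fun k _ => ?_
    rw [← Finset.sum_mul, pow_two]
    congr 1
    rw [hb k]
    exact Finset.sum_congr rfl fun j _ => mul_comm _ _
  have s2 : ∑ i, ∑ k, H i k * b i * ν k = B := by
    rw [Finset.sum_comm, ← s1]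
    exact Finset.sum_congr rfl fun i _ => Finset.sum_congr rfl fun k _ => by rw [hH]; ring
  have s3 : ∑ i, ∑ k, H i k * ν i * ν k = β := by
    rw [Finset.sum_comm, hβ]
    refine Finset.sum_congr rfl fun k _ => ?_
    rw [← Finset.sum_mul, mul_comm]
    congr 1
    rw [hb k]
    exact Finset.sum_congr rfl fun j _ => mul_comm _ _
  have s4 : ∑ i, ∑ k, (ν i * b i) * (ν k * b k) = β ^ 2 := by
    rw [← Finset.sum_mul_sum, pow_two]
  have s5 : ∑ i, ∑ k, ν i ^ 2 * b k ^ 2 = τ * B := (Finset.sum_mul_sum _ _ _ _).symm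
  have s6 : ∑ i, ∑ k, b i ^ 2 * ν k ^ 2 = τ * B := by
    rw [← Finset.sum_mul_sum, mul_comm]
  have s7 : ∑ i, ∑ k, ν i ^ 2 * ν k ^ 2 = τ ^ 2 := by
    rw [← Finset.sum_mul_sum, pow_two]
  have s8 : ∑ i, ∑ k, ν i ^ 2 * (ν k * b k) = τ * β := (Finset.sum_mul_sum _ _ _ _).symm
  have s9 : ∑ i, ∑ k, (ν i * b i) * ν k ^ 2 = τ * β := by
    rw [← Finset.sum_mul_sum, mul_comm]
  have pull : ∀ (c : ℝ) (T : ι → ι → ℝ), ∑ i, ∑ k, c * T i k = c * ∑ i, ∑ k, T i k := by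
    intro c T
    simp only [Finset.mul_sum]
  set Q := ∑ i, ∑ k, H i k ^ 2 with hQ
  have e1 : ∑ i, ∑ k, (H i k - ν i * b k) * (H k i - ν k * b i) = Q - 2 * B + β ^ 2 := by
    have : ∀ i k, (H i k - ν i * b k) * (H k i - ν k * b i) =
        H i k ^ 2 - H i k * b i * ν k - H i k * ν i * b k + (ν i * b i) * (ν k * b k) := by
      intro i k; rw [hH k i]; ring
    simp only [this, Finset.sum_add_distrib, Finset.sum_sub_distrib, s1, s2, s4]
    ring
  have e2 : ∑ i, ∑ k, (H i k - ν i * b k - b i * ν k + β * (ν i * ν k)) ^ 2 =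
      Q - (4 - 2 * τ) * B + (2 - τ) ^ 2 * β ^ 2 := by
    have : ∀ i k, (H i k - ν i * b k - b i * ν k + β * (ν i * ν k)) ^ 2 =
        H i k ^ 2 + ν i ^ 2 * b k ^ 2 + b i ^ 2 * ν k ^ 2 + β ^ 2 * (ν i ^ 2 * ν k ^ 2)
        - 2 * (H i k * ν i * b k) - 2 * (H i k * b i * ν k) + 2 * β * (H i k * ν i * ν k)
        + 2 * ((ν i * b i) * (ν k * b k)) - 2 * β * (ν i ^ 2 * (ν k * b k))
        - 2 * β * ((ν i * b i) * ν k ^ 2) := by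
      intro i k; ring
    simp only [this, Finset.sum_add_distrib, Finset.sum_sub_distrib, pull,
      s1, s2, s3, s4, s5, s6, s7, s8, s9]
    ring
  have hX : 0 ≤ Q - (4 - 2 * τ) * B + (2 - τ) ^ 2 * β ^ 2 := by
    rw [← e2]; positivity
  have hcs : β ^ 2 ≤ τ * B := Finset.sum_mul_sq_le_sq_mul_sq _ _ _
  have hτ0 : 0 ≤ τ := by positivity
  have hB0 : 0 ≤ B := by positivity
  rw [e1]
  have h1 : 0 ≤ (1 - τ) * (3 - τ) * (τ * B - β ^ 2) :=
    mul_nonneg (mul_nonneg (by linarith) (by linarith)) (by linarith)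
  have h2 : 0 ≤ (1 - τ) ^ 2 * (2 - τ) * B :=
    mul_nonneg (mul_nonneg (sq_nonneg _) (by linarith)) hB0
  linarith

end Algebra

section Graph
variable {n : ℕ}

local notation "E" => EuclideanSpace ℝ (Fin n)

/-- The area element `√(1 + |Du|²)` of the graph of `u`. -/
noncomputable def areaElement (u : E → ℝ) (x : E) : ℝ := Real.sqrt (1 + ‖fderiv ℝ u x‖ ^ 2)

/-- The horizontal components `Dᵢu / √(1 + |Du|²)` of the unit normal of the graph of `u`. -/
noncomputable def graphNormal (u : E → ℝ) (i : Fin n) (x : E) : ℝ :=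
  partialDeriv i u x / areaElement u x

lemma areaElement_sq (u : E → ℝ) (x : E) : areaElement u x ^ 2 = 1 + ‖fderiv ℝ u x‖ ^ 2 :=
  Real.sq_sqrt (by positivity)

lemma one_le_areaElement (u : E → ℝ) (x : E) : 1 ≤ areaElement u x :=
  Real.one_le_sqrt.2 (by nlinarith [sq_nonneg ‖fderiv ℝ u x‖])

lemma areaElement_pos (u : E → ℝ) (x : E) : 0 < areaElement u x :=
  one_pos.trans_le (one_le_areaElement u x)

lemma areaElement_mul_graphNormal (u : E → ℝ) (i : Fin n) (x : E) :
    areaElement u x * graphNormal u i x = partialDeriv i u x :=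
  mul_div_cancel₀ _ (areaElement_pos u x).ne'

lemma sum_graphNormal_sq (u : E → ℝ) (x : E) :
    ∑ i, graphNormal u i x ^ 2 = 1 - 1 / areaElement u x ^ 2 := by
  have h0 := (areaElement_pos u x).ne'
  simp only [graphNormal, div_pow, ← Finset.sum_div, ← norm_fderiv_sq]
  rw [eq_sub_iff_add_eq, ← add_div, add_comm, ← areaElement_sq]
  exact div_self (pow_ne_zero 2 h0)

lemma contDiff_partialDeriv {u : E → ℝ} (hu : ContDiff ℝ 2 u) (i : Fin n) :
    ContDiff ℝ 1 (partialDeriv i u) :=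
  ContDiff.partialDeriv (m := 2) (k := 1) hu (by norm_num) i

lemma contDiff_areaElement {u : E → ℝ} (hu : ContDiff ℝ 2 u) : ContDiff ℝ 1 (areaElement u) := by
  have h : areaElement u = fun x => Real.sqrt (1 + ∑ i, partialDeriv i u x ^ 2) := by
    ext x; rw [areaElement, norm_fderiv_sq]
  rw [h]
  refine ContDiff.sqrt (contDiff_const.add (ContDiff.sum fun i _ =>
    (contDiff_partialDeriv hu i).pow 2)) fun x => ?_
  positivity

lemma contDiff_graphNormal {u : E → ℝ} (hu : ContDiff ℝ 2 u) (i : Fin n) :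
    ContDiff ℝ 1 (graphNormal u i) :=
  (contDiff_partialDeriv hu i).div (contDiff_areaElement hu) fun x => (areaElement_pos u x).ne'

lemma partialDeriv_sum {ι : Type*} (s : Finset ι) {f : ι → E → ℝ} {x : E}
    (hf : ∀ j ∈ s, DifferentiableAt ℝ (f j) x) (i : Fin n) :
    partialDeriv i (fun y => ∑ j ∈ s, f j y) x = ∑ j ∈ s, partialDeriv i (f j) x := by
  simp [partialDeriv, fderiv_fun_sum hf]

lemma partialDeriv_areaElement {u : E → ℝ} (hu : ContDiff ℝ 2 u) (k : Fin n) (x : E) :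
    partialDeriv k (areaElement u) x =
      ∑ j, graphNormal u j x * partialDeriv k (partialDeriv j u) x := by
  have hp : ∀ j, DifferentiableAt ℝ (partialDeriv j u) x := fun j =>
    (contDiff_partialDeriv hu j).differentiable one_ne_zero x
  have hW : DifferentiableAt ℝ (areaElement u) x :=
    (contDiff_areaElement hu).differentiable one_ne_zero x
  have h0 := (areaElement_pos u x).ne'
  have h1 : partialDeriv k (fun y => areaElement u y * areaElement u y) x =
      2 * (areaElement u x * partialDeriv k (areaElement u) x) := by
    rw [partialDeriv_mul hW hW]; ring
  have h2 : (fun y => areaElement u y * areaElement u y) =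
      fun y => 1 + ∑ j, partialDeriv j u y * partialDeriv j u y := by
    ext y
    rw [← pow_two, areaElement_sq, norm_fderiv_sq]
    simp only [pow_two]
  have h3 : partialDeriv k (fun y => 1 + ∑ j, partialDeriv j u y * partialDeriv j u y) x =
      2 * ∑ j, partialDeriv j u x * partialDeriv k (partialDeriv j u) x := by
    have : partialDeriv k (fun y => 1 + ∑ j, partialDeriv j u y * partialDeriv j u y) x =
        partialDeriv k (fun y => ∑ j, partialDeriv j u y * partialDeriv j u y) x := by
      simp only [partialDeriv, fderiv_const_add]
    rw [this, partialDeriv_sum _ fun j _ => (hp j).fun_mul (hp j), Finset.mul_sum]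
    refine Finset.sum_congr rfl fun j _ => ?_
    rw [partialDeriv_mul (hp j) (hp j)]; ring
  rw [h2, h3] at h1
  have h4 : areaElement u x * partialDeriv k (areaElement u) x =
      areaElement u x * ∑ j, graphNormal u j x * partialDeriv k (partialDeriv j u) x := by
    rw [Finset.mul_sum]
    simp only [← mul_assoc, areaElement_mul_graphNormal]
    linarith
  exact mul_left_cancel₀ h0 h4

lemma partialDeriv_graphNormal {u : E → ℝ} (hu : ContDiff ℝ 2 u) (i k : Fin n) (x : E) :
    partialDeriv k (graphNormal u i) x = (partialDeriv k (partialDeriv i u) x -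
      graphNormal u i x * partialDeriv k (areaElement u) x) / areaElement u x := by
  have h0 := (areaElement_pos u x).ne'
  have h1 : partialDeriv k (fun y => areaElement u y * graphNormal u i y) x = _ :=
    partialDeriv_mul ((contDiff_areaElement hu).differentiable one_ne_zero x)
      ((contDiff_graphNormal hu i).differentiable one_ne_zero x) k
  have h2 : (fun y => areaElement u y * graphNormal u i y) = partialDeriv i u :=
    funext (areaElement_mul_graphNormal u i)
  rw [h2] at h1
  rw [h1]
  field_simp
  ring

/-- Weak form of the minimal surface equation. -/
lemma integral_graphNormal_mul_partialDeriv {u : E → ℝ} (hu : ContDiff ℝ 2 u) {U : Set E}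
    (hU : ∀ x ∈ U, ∑ i, partialDeriv i (graphNormal u i) x = 0) {φ : E → ℝ}
    (hφ : ContDiff ℝ 1 φ) (hc : HasCompactSupport φ) (hs : tsupport φ ⊆ U) :
    ∫ x, ∑ i, graphNormal u i x * partialDeriv i φ x = 0 := by
  have hd : ∀ i x, DifferentiableAt ℝ (graphNormal u i) x := fun i x =>
    (contDiff_graphNormal hu i).differentiable one_ne_zero x
  have hφd : ∀ x, DifferentiableAt ℝ φ x := fun x => hφ.differentiable one_ne_zero x
  have hC : ∀ i, ContDiff ℝ 1 fun x => graphNormal u i x * φ x := fun i =>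
    (contDiff_graphNormal hu i).mul hφ
  have hcs : ∀ i, HasCompactSupport fun x => graphNormal u i x * φ x := fun i => hc.mul_left
  have h : ∀ x, ∑ i, graphNormal u i x * partialDeriv i φ x =
      ∑ i, partialDeriv i (fun y => graphNormal u i y * φ y) x := by
    intro x
    have : ∀ i, partialDeriv i (fun y => graphNormal u i y * φ y) x =
        graphNormal u i x * partialDeriv i φ x + partialDeriv i (graphNormal u i) x * φ x :=
      fun i => partialDeriv_mul (hd i x) (hφd x) i
    simp only [this, Finset.sum_add_distrib, ← Finset.sum_mul]
    by_cases hx : x ∈ tsupport φ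
    · simp [hU x (hs hx)]
    · simp [image_eq_zero_of_notMem_tsupport hx]
  simp only [h]
  rw [integral_finsetSum _ fun i _ => ((hC i).continuous_partialDeriv i).integrable_of_hasCompactSupport
    ((hcs i).partialDeriv i)]
  exact Finset.sum_eq_zero fun i _ => integral_partialDeriv_eq_zero (hC i) (hcs i) i

/-- The differentiated minimal surface equation in weak form. -/
lemma integral_partialDeriv_graphNormal_mul {u : E → ℝ} (hu : ContDiff ℝ 2 u) {U : Set E}
    (hUo : IsOpen U) (hU : ∀ x ∈ U, ∑ i, partialDeriv i (graphNormal u i) x = 0) {φ : E → ℝ}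
    (hφ : ContDiff ℝ 1 φ) (hc : HasCompactSupport φ) (hs : tsupport φ ⊆ U) (k : Fin n) :
    ∫ x, ∑ i, partialDeriv k (graphNormal u i) x * partialDeriv i φ x = 0 := by
  set v : E := EuclideanSpace.single k 1 with hv
  have hgc : ∀ i, Continuous (graphNormal u i) := fun i => (contDiff_graphNormal hu i).continuous
  have hpc : ∀ i, Continuous (partialDeriv i φ) := fun i => hφ.continuous_partialDeriv i
  have hd := HasDerivAt.fun_sum (u := Finset.univ) fun i _ => hasDerivAt_integral_translate_mul
    (contDiff_graphNormal hu i) (hpc i) (hc.partialDeriv i) v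
  have hzero : ∀ᶠ t : ℝ in nhds 0,
      ∑ i, ∫ x, graphNormal u i (x + t • v) * partialDeriv i φ x = 0 := by
    obtain ⟨δ, hδ, hδU⟩ := IsCompact.exists_thickening_subset_open hc hUo hs
    have hsm : ∀ᶠ t : ℝ in nhds 0, ‖t • v‖ < δ := by
      have : Continuous fun t : ℝ => ‖t • v‖ := by fun_prop
      exact this.continuousAt.eventually_lt continuousAt_const (by simpa using hδ)
    filter_upwards [hsm] with t ht
    have hφt : ContDiff ℝ 1 fun x => φ (x - t • v) := hφ.comp (by fun_prop)
    have hct : HasCompactSupport fun x => φ (x - t • v) := by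
      simpa [sub_eq_add_neg] using! hc.comp_homeomorph (Homeomorph.addRight (-(t • v)))
    have hst : tsupport (fun x => φ (x - t • v)) ⊆ U := by
      intro x hx
      have h1 : x - t • v ∈ tsupport φ :=
        tsupport_comp_subset_preimage φ (f := fun x => x - t • v) (by fun_prop) hx
      refine hδU (mem_thickening_iff.2 ⟨_, h1, ?_⟩)
      simpa [dist_eq_norm] using ht
    have hw := integral_graphNormal_mul_partialDeriv hu hU hφt hct hst
    have hpt : ∀ i x, partialDeriv i (fun y => φ (y - t • v)) x = partialDeriv i φ (x - t • v) := by
      intro i x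
      simp [partialDeriv, fderiv_comp_sub]
    simp only [hpt] at hw
    rw [← integral_add_right_eq_self _ (t • v)] at hw
    simp only [add_sub_cancel_right] at hw
    rw [← hw, integral_finsetSum]
    intro i _
    exact (((hgc i).comp (by fun_prop)).mul (hpc i)).integrable_of_hasCompactSupport
      (hc.partialDeriv i).mul_left
  have hd0 := (hasDerivAt_const (0 : ℝ) (0 : ℝ)).congr_of_eventuallyEq hzero
  rw [integral_finsetSum]
  · exact hd.unique hd0
  · intro i _
    exact (((contDiff_graphNormal hu i).continuous_partialDeriv k).mul
      (hpc i)).integrable_of_hasCompactSupport (hc.partialDeriv i).mul_left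

/-- `1 / √(1 + |Du|²)` is superharmonic on a minimal graph (weak form). -/
lemma integral_graphNormal_subharmonic {u : E → ℝ} (hu : ContDiff ℝ 2 u) {U : Set E}
    (hUo : IsOpen U) (hU : ∀ x ∈ U, ∑ i, partialDeriv i (graphNormal u i) x = 0) {ζ : E → ℝ}
    (hζ : ContDiff ℝ 1 ζ) (hc : HasCompactSupport ζ) (hs : tsupport ζ ⊆ U) (h0 : ∀ x, 0 ≤ ζ x) :
    ∫ x, ∑ i, (∑ k, graphNormal u k x * partialDeriv k (graphNormal u i) x) * partialDeriv i ζ x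
      ≤ 0 := by
  have hg := fun i => contDiff_graphNormal hu i
  have hgd : ∀ i x, DifferentiableAt ℝ (graphNormal u i) x := fun i x =>
    (hg i).differentiable one_ne_zero x
  have hgc : ∀ i, Continuous (graphNormal u i) := fun i => (hg i).continuous
  have hgp : ∀ i k, Continuous (partialDeriv k (graphNormal u i)) := fun i k =>
    (hg i).continuous_partialDeriv k
  have hζc := hζ.continuous
  have hζp : ∀ i, Continuous (partialDeriv i ζ) := fun i => hζ.continuous_partialDeriv i
  have h1 : ∀ k, ∫ x, ∑ i, partialDeriv k (graphNormal u i) x *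
      partialDeriv i (fun y => graphNormal u k y * ζ y) x = 0 := fun k =>
    integral_partialDeriv_graphNormal_mul hu hUo hU ((hg k).mul hζ) hc.mul_left
      ((tsupport_mul_subset_right).trans hs) k
  have hsplit : ∀ k x, ∑ i, partialDeriv k (graphNormal u i) x *
      partialDeriv i (fun y => graphNormal u k y * ζ y) x =
      ∑ i, graphNormal u k x * partialDeriv k (graphNormal u i) x * partialDeriv i ζ x +
      ζ x * ∑ i, partialDeriv k (graphNormal u i) x * partialDeriv i (graphNormal u k) x := by
    intro k x
    rw [Finset.mul_sum, ← Finset.sum_add_distrib]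
    refine Finset.sum_congr rfl fun i _ => ?_
    rw [partialDeriv_mul (hgd k x) (hζ.differentiable one_ne_zero x)]
    ring
  have hI1 : ∀ k, Integrable fun x =>
      ∑ i, graphNormal u k x * partialDeriv k (graphNormal u i) x * partialDeriv i ζ x := fun k =>
    integrable_finsetSum _ fun i _ => (((hgc k).mul (hgp i k)).mul
      (hζp i)).integrable_of_hasCompactSupport (hc.partialDeriv i).mul_left
  have hI2 : ∀ k, Integrable fun x => ζ x *
      ∑ i, partialDeriv k (graphNormal u i) x * partialDeriv i (graphNormal u k) x := fun k =>
    (hζc.mul (continuous_finsetSum _ fun i _ =>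
      (hgp i k).mul (hgp k i))).integrable_of_hasCompactSupport hc.mul_right
  have h2 : (∑ k, ∫ x, ∑ i, graphNormal u k x * partialDeriv k (graphNormal u i) x *
      partialDeriv i ζ x) + ∑ k, ∫ x, ζ x * ∑ i, partialDeriv k (graphNormal u i) x *
        partialDeriv i (graphNormal u k) x = 0 := by
    rw [← Finset.sum_add_distrib]
    refine Finset.sum_eq_zero fun k _ => ?_
    rw [← integral_add (hI1 k) (hI2 k), ← h1 k]
    simp only [hsplit]
  rw [← integral_finsetSum _ fun k _ => hI1 k, ← integral_finsetSum _ fun k _ => hI2 k] at h2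
  have h3 : 0 ≤ ∫ x, ∑ k, ζ x * ∑ i, partialDeriv k (graphNormal u i) x *
        partialDeriv i (graphNormal u k) x := by
    refine integral_nonneg fun x => ?_
    simp only [← Finset.mul_sum]
    refine mul_nonneg (h0 x) ?_
    have hW := areaElement_pos u x
    have ht := sum_mul_swap_nonneg (fun i => graphNormal u i x)
      (fun k => partialDeriv k (areaElement u) x) (fun i k => partialDeriv k (partialDeriv i u) x)
      (fun i k => partialDeriv_comm hu k i x) (fun k => partialDeriv_areaElement hu k x)
      (by rw [sum_graphNormal_sq]; have : 0 ≤ 1 / areaElement u x ^ 2 := by positivity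
          linarith)
    have he : ∑ k, ∑ i, partialDeriv k (graphNormal u i) x * partialDeriv i (graphNormal u k) x =
        (∑ i, ∑ k, (partialDeriv k (partialDeriv i u) x -
          graphNormal u i x * partialDeriv k (areaElement u) x) *
          (partialDeriv i (partialDeriv k u) x -
          graphNormal u k x * partialDeriv i (areaElement u) x)) / areaElement u x ^ 2 := by
      rw [Finset.sum_comm, Finset.sum_div]
      refine Finset.sum_congr rfl fun i _ => ?_
      rw [Finset.sum_div]
      refine Finset.sum_congr rfl fun k _ => ?_
      rw [partialDeriv_graphNormal hu, partialDeriv_graphNormal hu]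
      field_simp
    rw [he]
    exact div_nonneg ht (by positivity)
  have h4 : ∀ x, ∑ i, (∑ k, graphNormal u k x * partialDeriv k (graphNormal u i) x) *
      partialDeriv i ζ x =
      ∑ k, ∑ i, graphNormal u k x * partialDeriv k (graphNormal u i) x * partialDeriv i ζ x := by
    intro x
    rw [Finset.sum_comm]
    simp only [Finset.sum_mul]
  simp only [h4]
  linarith

end Graph

section Monotonicity
variable {n : ℕ}

local notation "E" => EuclideanSpace ℝ (Fin n)

lemma contDiff_one_comp_of_nonneg {g g' : ℝ → ℝ} {ε : ℝ} (hε : 0 < ε)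
    (hg : ∀ t, -ε < t → HasDerivAt g (g' t) t) (hg' : ContinuousOn g' (Ioi (-ε))) {s : E → ℝ}
    (hs : ContDiff ℝ 1 s) (h0 : ∀ x, 0 ≤ s x) : ContDiff ℝ 1 fun x => g (s x) := by
  have hlt : ∀ x, -ε < s x := fun x => by linarith [h0 x]
  have hd : ∀ x, HasFDerivAt (fun x => g (s x)) (g' (s x) • fderiv ℝ s x) x := fun x =>
    (hg _ (hlt x)).comp_hasFDerivAt x (hs.differentiable one_ne_zero x).hasFDerivAt
  rw [contDiff_one_iff_fderiv]
  refine ⟨fun x => (hd x).differentiableAt, ?_⟩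
  have : fderiv ℝ (fun x => g (s x)) = fun x => g' (s x) • fderiv ℝ s x :=
    funext fun x => (hd x).fderiv
  rw [this]
  exact (hg'.comp_continuous hs.continuous hlt).smul (hs.continuous_fderiv one_ne_zero)

/-- The squared distance in `ℝⁿ × ℝ` between the points of the graph of `u` over `x` and `0`. -/
noncomputable def graphDistSq (u : E → ℝ) (x : E) : ℝ := ∑ i, x i ^ 2 + (u x - u 0) ^ 2

/-- The horizontal part of the position vector of the graph of `u`, projected to the graph. -/
noncomputable def graphRadial (u : E → ℝ) (i : Fin n) (x : E) : ℝ :=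
  areaElement u x * x i - partialDeriv i u x * ∑ k, graphNormal u k x * x k +
    (u x - u 0) * graphNormal u i x

/-- A function vanishing to second order in the slope of `u`, subharmonic on minimal graphs. -/
noncomputable def tilt (u : E → ℝ) (x : E) : ℝ := 1 - (areaElement u x)⁻¹

lemma tilt_nonneg (u : E → ℝ) (x : E) : 0 ≤ tilt u x :=
  sub_nonneg.2 (inv_le_one_of_one_le₀ (one_le_areaElement u x))

lemma contDiff_tilt {u : E → ℝ} (hu : ContDiff ℝ 2 u) : ContDiff ℝ 1 (tilt u) :=
  contDiff_const.sub ((contDiff_areaElement hu).inv fun x => (areaElement_pos u x).ne')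

lemma partialDeriv_tilt {u : E → ℝ} (hu : ContDiff ℝ 2 u) (i : Fin n) (x : E) :
    partialDeriv i (tilt u) x = partialDeriv i (areaElement u) x / areaElement u x ^ 2 := by
  have h := partialDeriv_comp (g := fun w => 1 - w⁻¹) (x := x)
    ((hasDerivAt_inv (areaElement_pos u x).ne').const_sub 1)
    ((contDiff_areaElement hu).differentiable one_ne_zero x) i
  have h2 : partialDeriv i (tilt u) x = _ := h
  rw [h2]
  ring

lemma graphDistSq_nonneg (u : E → ℝ) (x : E) : 0 ≤ graphDistSq u x := by
  unfold graphDistSq; positivity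

lemma norm_sq_le_graphDistSq (u : E → ℝ) (x : E) : ‖x‖ ^ 2 ≤ graphDistSq u x := by
  rw [EuclideanSpace.real_norm_sq_eq, graphDistSq]
  linarith [sq_nonneg (u x - u 0)]

lemma contDiff_coord (i : Fin n) : ContDiff ℝ 1 fun x : E => x i :=
  (EuclideanSpace.proj i : E →L[ℝ] ℝ).contDiff

lemma contDiff_graphDistSq {u : E → ℝ} (hu : ContDiff ℝ 2 u) : ContDiff ℝ 1 (graphDistSq u) :=
  (ContDiff.sum fun i _ => (contDiff_coord i).pow 2).add
    (((hu.of_le (by norm_num)).sub contDiff_const).pow 2)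

lemma contDiff_graphRadial {u : E → ℝ} (hu : ContDiff ℝ 2 u) (i : Fin n) :
    ContDiff ℝ 1 (graphRadial u i) :=
  (((contDiff_areaElement hu).mul (contDiff_coord i)).sub ((contDiff_partialDeriv hu i).mul
    (ContDiff.sum fun k _ => (contDiff_graphNormal hu k).mul (contDiff_coord k)))).add
    (((hu.of_le (by norm_num)).sub contDiff_const).mul (contDiff_graphNormal hu i))

lemma partialDeriv_sub_const (i : Fin n) (f : E → ℝ) (c : ℝ) (x : E) :
    partialDeriv i (fun y => f y - c) x = partialDeriv i f x := by
  simp only [partialDeriv, fderiv_sub_const]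

lemma partialDeriv_add {f g : E → ℝ} {x : E} (hf : DifferentiableAt ℝ f x)
    (hg : DifferentiableAt ℝ g x) (i : Fin n) :
    partialDeriv i (fun y => f y + g y) x = partialDeriv i f x + partialDeriv i g x := by
  simp [partialDeriv, fderiv_fun_add hf hg]

lemma partialDeriv_sub {f g : E → ℝ} {x : E} (hf : DifferentiableAt ℝ f x)
    (hg : DifferentiableAt ℝ g x) (i : Fin n) :
    partialDeriv i (fun y => f y - g y) x = partialDeriv i f x - partialDeriv i g x := by
  simp [partialDeriv, fderiv_fun_sub hf hg]

lemma partialDeriv_graphDistSq {u : E → ℝ} (hu : ContDiff ℝ 2 u) (i : Fin n) (x : E) :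
    partialDeriv i (graphDistSq u) x = 2 * (x i + (u x - u 0) * partialDeriv i u x) := by
  have hud : DifferentiableAt ℝ u x := hu.differentiable two_ne_zero x
  have hx : ∀ j, DifferentiableAt ℝ (fun y : E => y j) x := fun j =>
    (contDiff_coord j).differentiable one_ne_zero x
  have h1 : graphDistSq u = fun y => ∑ j, y j * y j + (u y - u 0) * (u y - u 0) := by
    ext y; simp only [graphDistSq, pow_two]
  rw [h1, partialDeriv_add (by fun_prop) (by fun_prop),
    partialDeriv_sum _ fun j _ => (hx j).fun_mul (hx j),
    partialDeriv_mul (by fun_prop) (by fun_prop), partialDeriv_sub_const]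
  simp only [partialDeriv_mul (hx _) (hx _), partialDeriv_coord]
  simp [Finset.sum_add_distrib]
  ring

/-- The first variation formula `div_M X = n` on a minimal graph. -/
lemma sum_partialDeriv_graphRadial {u : E → ℝ} (hu : ContDiff ℝ 2 u) {x : E}
    (hx : ∑ i, partialDeriv i (graphNormal u i) x = 0) :
    ∑ i, partialDeriv i (graphRadial u i) x = n * areaElement u x := by
  have hW0 := areaElement_pos u x
  have hud : DifferentiableAt ℝ u x := hu.differentiable two_ne_zero x
  have hxd : ∀ j, DifferentiableAt ℝ (fun y : E => y j) x := fun j =>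
    (contDiff_coord j).differentiable one_ne_zero x
  have hWd := (contDiff_areaElement hu).differentiable one_ne_zero x
  have hνd : ∀ j, DifferentiableAt ℝ (graphNormal u j) x := fun j =>
    (contDiff_graphNormal hu j).differentiable one_ne_zero x
  have hpd : ∀ j, DifferentiableAt ℝ (partialDeriv j u) x := fun j =>
    (contDiff_partialDeriv hu j).differentiable one_ne_zero x
  have hsd : DifferentiableAt ℝ (fun y => ∑ k, graphNormal u k y * y k) x :=
    DifferentiableAt.fun_sum fun k _ => (hνd k).fun_mul (hxd k)
  set W := areaElement u x with hW
  set ν := fun i => graphNormal u i x with hν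
  set b := fun k => partialDeriv k (areaElement u) x with hb
  set H := fun i k => partialDeriv k (partialDeriv i u) x with hH
  set y := ∑ k, ν k * x k with hy
  set β := ∑ k, ν k * b k with hβ
  have hsym : ∀ i k, H i k = H k i := fun i k => partialDeriv_comm hu k i x
  have hbe : ∀ k, b k = ∑ j, ν j * H j k := fun k => partialDeriv_areaElement hu k x
  have hdν : ∀ i k, partialDeriv k (graphNormal u i) x = (H i k - ν i * b k) / W := fun i k =>
    partialDeriv_graphNormal hu i k x
  have hlap : ∑ i, H i i = β := by
    simp only [hdν, ← Finset.sum_div, Finset.sum_sub_distrib] at hx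
    rcases div_eq_zero_iff.1 hx with h | h
    · linarith
    · exact absurd h hW0.ne'
  have hpi : ∀ i, partialDeriv i u x = W * ν i := fun i =>
    (areaElement_mul_graphNormal u i x).symm
  have hdy : ∀ i, partialDeriv i (fun y => ∑ k, graphNormal u k y * y k) x =
      ν i + ∑ k, (H k i - ν k * b i) / W * x k := by
    intro i
    rw [partialDeriv_sum _ fun k _ => (hνd k).fun_mul (hxd k)]
    simp only [partialDeriv_mul (hνd _) (hxd _), partialDeriv_coord, hdν, Finset.sum_add_distrib]
    simp [hν]
  have hterm : ∀ i, partialDeriv i (graphRadial u i) x =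
      W + b i * x i - W * ν i * (ν i + ∑ k, (H k i - ν k * b i) / W * x k) - H i i * y +
        ((u x - u 0) * partialDeriv i (graphNormal u i) x + W * ν i * ν i) := by
    intro i
    have : graphRadial u i = fun y => areaElement u y * y i -
      partialDeriv i u y * ∑ k, graphNormal u k y * y k + (u y - u 0) * graphNormal u i y := rfl
    rw [this, partialDeriv_add ((hWd.fun_mul (hxd i)).fun_sub ((hpd i).fun_mul hsd))
        ((hud.sub_const _).fun_mul (hνd i)),
      partialDeriv_sub (hWd.fun_mul (hxd i)) ((hpd i).fun_mul hsd),
      partialDeriv_mul hWd (hxd i), partialDeriv_mul (hpd i) hsd,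
      partialDeriv_mul (hud.sub_const _) (hνd i), partialDeriv_sub_const, hdy, partialDeriv_coord,
      hpi]
    simp only [if_true]
    ring
  have hcross : ∑ i, W * ν i * ∑ k, (H k i - ν k * b i) / W * x k = ∑ i, b i * x i - β * y := by
    have h1 : ∀ i, W * ν i * ∑ k, (H k i - ν k * b i) / W * x k =
        ∑ k, (ν i * H i k * x k - (ν i * b i) * (ν k * x k)) := by
      intro i
      rw [Finset.mul_sum]
      refine Finset.sum_congr rfl fun k _ => ?_
      rw [hsym k i]
      field_simp
    simp only [h1, Finset.sum_sub_distrib]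
    rw [← Finset.sum_mul_sum, Finset.sum_comm]
    simp only [← Finset.sum_mul, ← hbe]
    rfl
  have hsplit : ∀ i, partialDeriv i (graphRadial u i) x =
      W + b i * x i - W * ν i * (∑ k, (H k i - ν k * b i) / W * x k) - H i i * y +
        (u x - u 0) * partialDeriv i (graphNormal u i) x := fun i => by rw [hterm]; ring
  simp only [hsplit, Finset.sum_add_distrib, Finset.sum_sub_distrib, hcross, ← Finset.sum_mul,
    hlap, ← Finset.mul_sum, hx]
  simp
  ring

lemma sum_graphRadial_mul_partialDeriv_tilt {u : E → ℝ} (hu : ContDiff ℝ 2 u) (x : E) :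
    ∑ i, (∑ k, graphNormal u k x * partialDeriv k (graphNormal u i) x) *
      partialDeriv i (graphDistSq u) x =
    2 * ∑ i, graphRadial u i x * partialDeriv i (tilt u) x := by
  have hτ := sum_graphNormal_sq u x
  have hW0 := areaElement_pos u x
  simp only [partialDeriv_tilt hu, partialDeriv_graphDistSq hu, partialDeriv_graphNormal hu,
    graphRadial, ← areaElement_mul_graphNormal u _ x]
  set W := areaElement u x with hW
  set ν := fun i => graphNormal u i x with hν
  set b := fun k => partialDeriv k (areaElement u) x with hb
  set y := ∑ k, ν k * x k with hy
  set β := ∑ k, ν k * b k with hβ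
  set z := u x - u 0
  have hJ : ∀ i, ∑ k, ν k * ((partialDeriv k (partialDeriv i u) x - ν i * b k) / W) =
      (b i - ν i * β) / W := by
    intro i
    have hbi : b i = ∑ k, ν k * partialDeriv k (partialDeriv i u) x := by
      rw [hb]; simp only [partialDeriv_areaElement hu]
      exact Finset.sum_congr rfl fun k _ => by rw [partialDeriv_comm hu]
    rw [hbi, hβ, Finset.mul_sum, ← Finset.sum_sub_distrib, Finset.sum_div]
    exact Finset.sum_congr rfl fun k _ => by ring
  have h1 : ∀ i, (b i - ν i * β) / W * (2 * (x i + z * (W * ν i))) =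
      2 / W * (b i * x i) + 2 * z * (ν i * b i) - 2 * β / W * (ν i * x i) -
        2 * z * β * ν i ^ 2 := by
    intro i; field_simp; ring
  have h2 : ∀ i, (W * x i - W * ν i * y + z * ν i) * (b i / W ^ 2) =
      1 / W * (b i * x i) - y / W * (ν i * b i) + z / W ^ 2 * (ν i * b i) := by
    intro i; field_simp
  have e1 : ∑ i, (∑ k, ν k * ((partialDeriv k (partialDeriv i u) x - ν i * b k) / W)) *
      (2 * (x i + z * (W * ν i))) =
      2 / W * ∑ i, b i * x i + 2 * z * β - 2 * β / W * y - 2 * z * β * (1 - 1 / W ^ 2) := by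
    simp only [hJ, h1, Finset.sum_add_distrib, Finset.sum_sub_distrib, ← Finset.mul_sum]
    rw [hτ]
  have e2 : ∑ i, (W * x i - W * ν i * y + z * ν i) * (b i / W ^ 2) =
      1 / W * ∑ i, b i * x i - y / W * β + z / W ^ 2 * β := by
    simp only [h2, Finset.sum_add_distrib, Finset.sum_sub_distrib, ← Finset.mul_sum]
    rfl
  refine e1.trans ((?_ : _ = _).trans (congrArg (2 * ·) e2.symm))
  ring

lemma sum_graphRadial_mul_partialDeriv_graphDistSq_le {u : E → ℝ} (hu : ContDiff ℝ 2 u) (x : E) :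
    ∑ i, graphRadial u i x * partialDeriv i (graphDistSq u) x ≤
      2 * graphDistSq u x * areaElement u x := by
  have hτ := sum_graphNormal_sq u x
  have hW0 := areaElement_pos u x
  simp only [partialDeriv_graphDistSq hu, graphRadial, ← areaElement_mul_graphNormal u _ x,
    graphDistSq]
  set W := areaElement u x with hW
  set ν := fun i => graphNormal u i x with hν
  set y := ∑ k, ν k * x k with hy
  set z := u x - u 0
  have h1 : ∀ i, (W * x i - W * ν i * y + z * ν i) * (2 * (x i + z * (W * ν i))) =
      2 * W * x i ^ 2 + (2 * z * W ^ 2 - 2 * W * y + 2 * z) * (ν i * x i) +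
        (2 * z ^ 2 * W - 2 * z * W ^ 2 * y) * ν i ^ 2 := by
    intro i; ring
  have e1 : ∑ i, (W * x i - W * ν i * y + z * ν i) * (2 * (x i + z * (W * ν i))) =
      2 * W * ∑ i, x i ^ 2 + (2 * z * W ^ 2 - 2 * W * y + 2 * z) * y +
        (2 * z ^ 2 * W - 2 * z * W ^ 2 * y) * (1 - 1 / W ^ 2) := by
    simp only [h1, Finset.sum_add_distrib, ← Finset.mul_sum]
    rw [hτ]
  refine e1.le.trans ?_
  have h3 : 2 * W * ∑ i, x i ^ 2 + (2 * z * W ^ 2 - 2 * W * y + 2 * z) * y +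
        (2 * z ^ 2 * W - 2 * z * W ^ 2 * y) * (1 - 1 / W ^ 2) =
      2 * (∑ i, x i ^ 2 + z ^ 2) * W - 2 * ((W * y - z) ^ 2 / W) := by
    field_simp
    ring
  rw [h3]
  have : 0 ≤ (W * y - z) ^ 2 / W := by positivity
  linarith

end Monotonicity

section WeightedInequality
variable {n : ℕ}

local notation "E" => EuclideanSpace ℝ (Fin n)

lemma tsupport_comp_graphDistSq_subset (u : E → ℝ) {g : ℝ → ℝ} (hz : ∀ t, 1 / 4 ≤ t → g t = 0) :
    tsupport (fun x => g (graphDistSq u x)) ⊆ closedBall 0 (1 / 2) := by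
  refine closure_minimal (fun x hx => ?_) isClosed_closedBall
  rw [mem_closedBall_zero_iff]
  by_contra hlt
  push Not at hlt
  exact hx (hz _ (by nlinarith [norm_sq_le_graphDistSq u x]))

lemma hasCompactSupport_comp_graphDistSq (u : E → ℝ) {g : ℝ → ℝ}
    (hz : ∀ t, 1 / 4 ≤ t → g t = 0) : HasCompactSupport fun x => g (graphDistSq u x) :=
  (isCompact_closedBall _ _).of_isClosed_subset (isClosed_tsupport _)
    (tsupport_comp_graphDistSq_subset u hz)

/-- The weighted inequality from which the mean value inequality on minimal graphs follows. -/
lemma integral_tilt_mul_weight_nonpos {u : E → ℝ} (hu : ContDiff ℝ 2 u)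
    (hU : ∀ x ∈ ball (0 : E) 1, ∑ i, partialDeriv i (graphNormal u i) x = 0)
    {h h' : ℝ → ℝ} {ε : ℝ} (hε : 0 < ε) (hd : ∀ t, -ε < t → HasDerivAt h (h' t) t)
    (hc : ContinuousOn h' (Ioi (-ε))) (hpos : ∀ t, 0 ≤ t → 0 ≤ h t) (hneg : ∀ t, 0 ≤ t → h' t ≤ 0)
    (hz : ∀ t, 1 / 4 ≤ t → h t = 0) (hz' : ∀ t, 1 / 4 ≤ t → h' t = 0) :
    ∫ x, tilt u x * areaElement u x *
      (n * h (graphDistSq u x) + 2 * graphDistSq u x * h' (graphDistSq u x)) ≤ 0 := by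
  have hs := contDiff_graphDistSq hu
  have hs0 := graphDistSq_nonneg u
  have hlt : ∀ x, -ε < graphDistSq u x := fun x => by linarith [hs0 x]
  have hball : closedBall (0 : E) (1 / 2) ⊆ ball 0 1 := closedBall_subset_ball (by norm_num)
  have hhC : ContDiff ℝ 1 fun x => h (graphDistSq u x) :=
    contDiff_one_comp_of_nonneg hε hd hc hs hs0
  have hh'c : Continuous fun x => h' (graphDistSq u x) := hc.comp_continuous hs.continuous hlt
  have hhs := hasCompactSupport_comp_graphDistSq u hz
  have hh's := hasCompactSupport_comp_graphDistSq u hz'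
  have hhcont : ContinuousOn h (Ioi (-ε)) := fun t ht => (hd t ht).continuousAt.continuousWithinAt
  have hInt : ∀ a b, -ε < a → -ε < b → IntervalIntegrable h volume a b := fun a b ha hb =>
    (hhcont.mono fun t ht => (lt_min ha hb).trans_le ht.1).intervalIntegrable
  have hq : -ε < 1 / 4 := by linarith
  -- the primitive of the weight
  set Γ : ℝ → ℝ := fun t => ∫ r in t..(1 / 4), h r with hΓ
  have hΓd : ∀ t, -ε < t → HasDerivAt Γ (-h t) t := fun t ht =>
    intervalIntegral.integral_hasDerivAt_left (hInt _ _ ht hq)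
      (hhcont.stronglyMeasurableAtFilter isOpen_Ioi t ht) (hd t ht).continuousAt
  have hΓz : ∀ t, 1 / 4 ≤ t → Γ t = 0 := by
    intro t ht
    simp only [hΓ]
    rw [intervalIntegral.integral_symm, neg_eq_zero]
    refine (intervalIntegral.integral_congr (g := fun _ => (0 : ℝ)) fun r hr => ?_).trans (by simp)
    rw [uIcc_of_le ht] at hr
    exact hz r hr.1
  have hΓ0 : ∀ t, 0 ≤ t → 0 ≤ Γ t := by
    intro t ht
    rcases le_total t (1 / 4) with h1 | h1
    · exact intervalIntegral.integral_nonneg h1 fun r hr => hpos r (ht.trans hr.1)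
    · exact (hΓz t h1).ge
  have hζC : ContDiff ℝ 1 fun x => Γ (graphDistSq u x) :=
    contDiff_one_comp_of_nonneg hε hΓd hhcont.neg hs hs0
  have hsub := integral_graphNormal_subharmonic hu isOpen_ball hU hζC
    (hasCompactSupport_comp_graphDistSq u hΓz)
    ((tsupport_comp_graphDistSq_subset u hΓz).trans hball) fun x => hΓ0 _ (hs0 x)
  have hpζ : ∀ i x, partialDeriv i (fun y => Γ (graphDistSq u y)) x =
      -h (graphDistSq u x) * partialDeriv i (graphDistSq u) x := fun i x =>
    partialDeriv_comp (hΓd _ (hlt x)) (hs.differentiable one_ne_zero x) i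
  have hsub' : 0 ≤ ∫ x, h (graphDistSq u x) *
      ∑ i, graphRadial u i x * partialDeriv i (tilt u) x := by
    have he : ∀ x, ∑ i, (∑ k, graphNormal u k x * partialDeriv k (graphNormal u i) x) *
        partialDeriv i (fun y => Γ (graphDistSq u y)) x = -2 * (h (graphDistSq u x) *
          ∑ i, graphRadial u i x * partialDeriv i (tilt u) x) := by
      intro x
      have h1 : -2 * (h (graphDistSq u x) * ∑ i, graphRadial u i x * partialDeriv i (tilt u) x) =
          -h (graphDistSq u x) * (2 * ∑ i, graphRadial u i x * partialDeriv i (tilt u) x) := by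
        ring
      rw [h1, ← sum_graphRadial_mul_partialDeriv_tilt hu, Finset.mul_sum]
      refine Finset.sum_congr rfl fun i _ => ?_
      rw [hpζ]; ring
    simp only [he, integral_const_mul] at hsub
    linarith
  have hfC := contDiff_tilt hu
  have hVC := fun i => contDiff_graphRadial hu i
  have hWc := (contDiff_areaElement hu).continuous
  have hGC : ∀ i, ContDiff ℝ 1 fun x => graphRadial u i x * (tilt u x * h (graphDistSq u x)) :=
    fun i => (hVC i).mul (hfC.mul hhC)
  have hGs : ∀ i, HasCompactSupport fun x =>
      graphRadial u i x * (tilt u x * h (graphDistSq u x)) := fun i => hhs.mul_left.mul_left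
  have hzero : ∫ x, ∑ i, partialDeriv i
      (fun y => graphRadial u i y * (tilt u y * h (graphDistSq u y))) x = 0 := by
    rw [integral_finsetSum _ fun i _ =>
      ((hGC i).continuous_partialDeriv i).integrable_of_hasCompactSupport ((hGs i).partialDeriv i)]
    exact Finset.sum_eq_zero fun i _ => integral_partialDeriv_eq_zero (hGC i) (hGs i) i
  have hI1 : Integrable fun x => tilt u x * areaElement u x *
      (n * h (graphDistSq u x) + 2 * graphDistSq u x * h' (graphDistSq u x)) := by
    refine Continuous.integrable_of_hasCompactSupport ?_ ?_
    · exact (hfC.continuous.mul hWc).mul ((continuous_const.mul hhC.continuous).add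
        ((continuous_const.mul hs.continuous).mul hh'c))
    · exact (hhs.mul_left.add hh's.mul_left).mul_left
  have hI2 : Integrable fun x => h (graphDistSq u x) *
      ∑ i, graphRadial u i x * partialDeriv i (tilt u) x :=
    (hhC.continuous.mul (continuous_finsetSum _ fun i _ => (hVC i).continuous.mul
      (hfC.continuous_partialDeriv i))).integrable_of_hasCompactSupport hhs.mul_right
  have hpt : ∀ x, tilt u x * areaElement u x *
      (n * h (graphDistSq u x) + 2 * graphDistSq u x * h' (graphDistSq u x)) +
      h (graphDistSq u x) * ∑ i, graphRadial u i x * partialDeriv i (tilt u) x ≤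
      ∑ i, partialDeriv i
        (fun y => graphRadial u i y * (tilt u y * h (graphDistSq u y))) x := by
    intro x
    have hsd := hs.differentiable one_ne_zero x
    have hprod : ∀ i, partialDeriv i
        (fun y => graphRadial u i y * (tilt u y * h (graphDistSq u y))) x =
        h' (graphDistSq u x) * tilt u x *
            (graphRadial u i x * partialDeriv i (graphDistSq u) x) +
          h (graphDistSq u x) * (graphRadial u i x * partialDeriv i (tilt u) x) +
          tilt u x * h (graphDistSq u x) * partialDeriv i (graphRadial u i) x := by
      intro i
      rw [partialDeriv_mul ((hVC i).differentiable one_ne_zero x)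
          ((hfC.mul hhC).differentiable one_ne_zero x),
        partialDeriv_mul (hfC.differentiable one_ne_zero x) (hhC.differentiable one_ne_zero x),
        partialDeriv_comp (hd _ (hlt x)) hsd]
      ring
    simp only [hprod, Finset.sum_add_distrib, ← Finset.mul_sum]
    have hlast : tilt u x * h (graphDistSq u x) * ∑ i, partialDeriv i (graphRadial u i) x =
        tilt u x * h (graphDistSq u x) * (n * areaElement u x) := by
      by_cases hx : x ∈ ball (0 : E) 1
      · rw [sum_partialDeriv_graphRadial hu (hU x hx)]
      · have : h (graphDistSq u x) = 0 := by
          refine hz _ ?_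
          rw [mem_ball_zero_iff, not_lt] at hx
          nlinarith [norm_sq_le_graphDistSq u x]
        simp [this]
    rw [hlast]
    have hle := mul_le_mul_of_nonpos_left (sum_graphRadial_mul_partialDeriv_graphDistSq_le hu x)
      (mul_nonpos_of_nonpos_of_nonneg (hneg _ (hs0 x)) (tilt_nonneg u x))
    linarith
  have hmono := integral_mono (hI1.add hI2) (integrable_finsetSum _ fun i _ =>
      ((hGC i).continuous_partialDeriv i).integrable_of_hasCompactSupport ((hGs i).partialDeriv i))
    hpt
  rw [hzero] at hmono
  simp only [Pi.add_apply] at hmono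
  rw [integral_add hI1 hI2] at hmono
  linarith

end WeightedInequality

section Caccioppoli
variable {n : ℕ}

local notation "E" => EuclideanSpace ℝ (Fin n)

lemma tilt_mul_areaElement (u : E → ℝ) (x : E) :
    tilt u x * areaElement u x = areaElement u x - 1 := by
  rw [tilt, sub_mul, inv_mul_cancel₀ (areaElement_pos u x).ne', one_mul]

/-- Caccioppoli inequality for the minimal surface equation. -/
lemma exists_integral_areaElement_sub_one_le :
    ∃ C : ℝ, 0 ≤ C ∧ ∀ u : E → ℝ, ContDiff ℝ 2 u →
      (∀ x ∈ ball (0 : E) 1, ∑ i, partialDeriv i (graphNormal u i) x = 0) →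
      ∫ x in closedBall (0 : E) (1 / 2), (areaElement u x - 1) ≤
        C * ∫ x in ball (0 : E) 1, u x ^ 2 := by
  let η : ContDiffBump (0 : E) := ⟨1 / 2, 3 / 4, by norm_num, by norm_num⟩
  have hη : ContDiff ℝ 1 η := η.contDiff
  have hηs : HasCompactSupport η := η.hasCompactSupport
  have hηb : tsupport η ⊆ ball (0 : E) 1 := by
    rw [η.tsupport_eq]; exact closedBall_subset_ball (by norm_num)
  obtain ⟨M, hM⟩ := (hηs.fderiv ℝ).exists_bound_of_continuous (hη.continuous_fderiv one_ne_zero)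
  refine ⟨4 * M ^ 2, by positivity, fun u hu hU => ?_⟩
  have hu1 : ContDiff ℝ 1 u := hu.of_le (by norm_num)
  have hWc := (contDiff_areaElement hu).continuous
  have hφ : ContDiff ℝ 1 fun x => u x * (η x * η x) := hu1.mul (hη.mul hη)
  have hφs : HasCompactSupport fun x => u x * (η x * η x) := hηs.mul_left.mul_left
  have hφb : tsupport (fun x => u x * (η x * η x)) ⊆ ball (0 : E) 1 :=
    (tsupport_mul_subset_right.trans tsupport_mul_subset_right).trans hηb
  have hweak := integral_graphNormal_mul_partialDeriv hu hU hφ hφs hφb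
  have hI0 : Integrable fun x => ∑ i, graphNormal u i x *
      partialDeriv i (fun x => u x * (η x * η x)) x :=
    integrable_finsetSum _ fun i _ => ((contDiff_graphNormal hu i).continuous.mul
      (hφ.continuous_partialDeriv i)).integrable_of_hasCompactSupport (hφs.partialDeriv i).mul_left
  have hfη : Continuous (fderiv ℝ η) := hη.continuous_fderiv one_ne_zero
  have hI1 : Integrable fun x => 2 * (u x ^ 2 * ‖fderiv ℝ η x‖ ^ 2) := by
    refine Continuous.integrable_of_hasCompactSupport ?_ ?_
    · exact continuous_const.mul ((hu.continuous.pow 2).mul (hfη.norm.pow 2))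
    · exact ((hηs.fderiv ℝ).norm.comp_left (g := fun r : ℝ => r ^ 2) (by simp)).mul_left.mul_left
  have hI2 : Integrable fun x => (η x * η x) * (areaElement u x - 1) :=
    (((hη.continuous.mul hη.continuous).mul (hWc.sub
      continuous_const))).integrable_of_hasCompactSupport hηs.mul_left.mul_right
  have hpt : ∀ x, 1 / 2 * ((η x * η x) * (areaElement u x - 1)) ≤
      ∑ i, graphNormal u i x * partialDeriv i (fun x => u x * (η x * η x)) x +
        2 * (u x ^ 2 * ‖fderiv ℝ η x‖ ^ 2) := by
    intro x
    have hud := hu1.differentiable one_ne_zero x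
    have hηd := hη.differentiable one_ne_zero x
    have hW1 := one_le_areaElement u x
    have hq := sum_graphNormal_sq u x
    set W := areaElement u x with hW
    set q := ∑ i, graphNormal u i x ^ 2 with hqd
    set a := ∑ i, graphNormal u i x * partialDeriv i η x with ha
    set D := ‖fderiv ℝ η x‖ with hD
    have hsum : ∑ i, graphNormal u i x * partialDeriv i (fun x => u x * (η x * η x)) x =
        W * q * (η x * η x) + 2 * u x * η x * a := by
      rw [hqd, ha, Finset.mul_sum, Finset.mul_sum, Finset.sum_mul, ← Finset.sum_add_distrib]
      refine Finset.sum_congr rfl fun i _ => ?_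
      rw [partialDeriv_mul hud (hηd.fun_mul hηd), partialDeriv_mul hηd hηd,
        ← areaElement_mul_graphNormal u i x]
      ring
    have hcs : a ^ 2 ≤ q * D ^ 2 := by
      rw [hD, norm_fderiv_sq]
      exact Finset.sum_mul_sq_le_sq_mul_sq _ _ _
    have hq0 : 0 ≤ q := by positivity
    have hWq : W - 1 ≤ W * q := by
      rw [hq, mul_sub, mul_one, pow_two]
      have : W * (1 / (W * W)) ≤ 1 := by
        rw [mul_one_div, mul_comm W W, div_mul_cancel_left₀ (by positivity)]
        exact inv_le_one_of_one_le₀ hW1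
      linarith
    rw [hsum]
    have hη0 : 0 ≤ η x * η x := mul_self_nonneg _
    have habs : |2 * u x * η x * a| ≤ 1 / 2 * (η x * η x) * q + 2 * (u x ^ 2 * D ^ 2) := by
      refine abs_le_of_sq_le_sq ?_ (by positivity)
      have h1 : (2 * u x * η x * a) ^ 2 ≤ 4 * u x ^ 2 * (η x * η x) * (q * D ^ 2) := by
        have : (2 * u x * η x * a) ^ 2 = 4 * u x ^ 2 * (η x * η x) * a ^ 2 := by ring
        rw [this]
        exact mul_le_mul_of_nonneg_left hcs (by positivity)
      nlinarith [sq_nonneg (1 / 2 * (η x * η x) * q - 2 * (u x ^ 2 * D ^ 2))]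
    have h2 := neg_le_of_abs_le habs
    have h3 : (η x * η x) * (W - 1) ≤ (η x * η x) * (W * q) := mul_le_mul_of_nonneg_left hWq hη0
    have h4 : (η x * η x) * q ≤ (η x * η x) * (W * q) :=
      mul_le_mul_of_nonneg_left (by nlinarith) hη0
    linarith
  have hmono := integral_mono (hI2.const_mul (1 / 2)) (hI0.add hI1) hpt
  simp only [Pi.add_apply] at hmono
  rw [integral_add hI0 hI1, hweak, integral_const_mul, integral_const_mul, zero_add] at hmono
  have hleft : ∫ x in closedBall (0 : E) (1 / 2), (areaElement u x - 1) ≤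
      ∫ x, (η x * η x) * (areaElement u x - 1) := by
    have h1 : ∫ x in closedBall (0 : E) (1 / 2), (areaElement u x - 1) =
        ∫ x in closedBall (0 : E) (1 / 2), (η x * η x) * (areaElement u x - 1) := by
      refine setIntegral_congr_fun measurableSet_closedBall fun x hx => ?_
      simp [η.one_of_mem_closedBall hx]
    rw [h1]
    refine setIntegral_le_integral hI2 (Filter.Eventually.of_forall fun x => ?_)
    exact mul_nonneg (mul_self_nonneg _) (sub_nonneg.2 (one_le_areaElement u x))
  have hright : ∫ x, u x ^ 2 * ‖fderiv ℝ η x‖ ^ 2 ≤ M ^ 2 * ∫ x in ball (0 : E) 1, u x ^ 2 := by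
    have hui : IntegrableOn (fun x => u x ^ 2) (ball (0 : E) 1) :=
      ((hu.continuous.pow 2).continuousOn.integrableOn_compact
        (isCompact_closedBall 0 1)).mono_set ball_subset_closedBall
    rw [← setIntegral_eq_integral_of_forall_compl_eq_zero (s := ball (0 : E) 1),
      ← integral_const_mul]
    · refine setIntegral_mono_on ?_ (hui.const_mul _) measurableSet_ball fun x _ => ?_
      · simpa using (hI1.const_mul (1 / 2)).integrableOn
      · rw [mul_comm]
        gcongr
        exact hM x
    · intro x hx
      have : fderiv ℝ η x = 0 := by
        by_contra h
        exact hx (hηb (support_fderiv_subset ℝ h))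
      simp [this]
  linarith

end Caccioppoli

section Weight

lemma hasDerivAt_posPart_sq (x : ℝ) : HasDerivAt (fun y : ℝ => max 0 y ^ 2) (2 * max 0 x) x := by
  rcases lt_trichotomy x 0 with hx | rfl | hx
  · rw [max_eq_left hx.le, mul_zero]
    refine (hasDerivAt_const x (0 : ℝ)).congr_of_eventuallyEq ?_
    filter_upwards [Iio_mem_nhds hx] with y hy
    simp [max_eq_left (mem_Iio.1 hy).le]
  · have h1 : HasDerivWithinAt (fun y : ℝ => max 0 y ^ 2) 0 (Iic 0) 0 :=
      (hasDerivWithinAt_const (0 : ℝ) _ (0 : ℝ)).congr (fun y hy => by simp [max_eq_left (mem_Iic.1 hy)])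
        (by simp)
    have h2 : HasDerivWithinAt (fun y : ℝ => max 0 y ^ 2) 0 (Ici 0) 0 := by
      have h3 : HasDerivWithinAt (fun y : ℝ => y ^ 2) 0 (Ici 0) 0 := by
        simpa using (hasDerivAt_pow 2 (0 : ℝ)).hasDerivWithinAt
      exact h3.congr (fun y hy => by rw [max_eq_right (mem_Ici.1 hy)]) (by simp)
    have h4 := h1.union h2
    rw [Iic_union_Ici, hasDerivWithinAt_univ] at h4
    simpa using h4
  · rw [max_eq_right hx.le]
    have h1 : HasDerivAt (fun y : ℝ => y ^ 2) (2 * x) x := by simpa using hasDerivAt_pow 2 x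
    refine h1.congr_of_eventuallyEq ?_
    filter_upwards [Ioi_mem_nhds hx] with y hy
    rw [max_eq_right (mem_Ioi.1 hy).le]

/-- A truncated fundamental solution `t ↦ (t + ε) ^ (-n/2)` with its almost superharmonicity. -/
lemma exists_weight (n : ℕ) {ε : ℝ} (hε : 0 < ε) :
    ∃ h h' : ℝ → ℝ, (∀ t, -ε < t → HasDerivAt h (h' t) t) ∧ ContinuousOn h' (Ioi (-ε)) ∧
      (∀ t, 0 ≤ t → 0 ≤ h t) ∧ (∀ t, 0 ≤ t → h' t ≤ 0) ∧ (∀ t, 1 / 4 ≤ t → h t = 0) ∧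
      (∀ t, 1 / 4 ≤ t → h' t = 0) ∧ (∀ t, 0 ≤ t → -(2 * n * 2 ^ n) ≤ n * h t + 2 * t * h' t) ∧
      ∀ t, 0 ≤ t → 2 * 2 ^ n ≤ (t + ε) ^ (-(n / 2 : ℝ)) →
        n * (ε / (2 * (t + ε)) * (t + ε) ^ (-(n / 2 : ℝ))) - 2 * n * 2 ^ n ≤
          n * h t + 2 * t * h' t := by
  set c : ℝ := 2 ^ n with hc
  have hc0 : 0 < c := by positivity
  set k : ℝ → ℝ := fun t => (t + ε) ^ (-(n / 2 : ℝ)) with hk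
  set m : ℝ → ℝ := fun t => max 0 (k t - c) with hm
  set k' : ℝ → ℝ := fun t => -(n / 2 : ℝ) * (t + ε) ^ (-(n / 2 : ℝ) - 1) with hk'
  have hσ : ∀ t, -ε < t → 0 < t + ε := fun t ht => by linarith
  have hk0 : ∀ t, -ε < t → 0 < k t := fun t ht => Real.rpow_pos_of_pos (hσ t ht) _
  have hkd : ∀ t, -ε < t → HasDerivAt k (k' t) t := fun t ht => by
    refine (((hasDerivAt_id t).add_const ε).rpow_const (p := -(n / 2 : ℝ))
      (Or.inl (hσ t ht).ne')).congr_deriv ?_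
    simp [hk']
  have hkk' : ∀ t, -ε < t → (t + ε) * k' t = -(n / 2 : ℝ) * k t := fun t ht => by
    simp only [hk, hk']
    rw [Real.rpow_sub_one (hσ t ht).ne']
    field_simp [(hσ t ht).ne']
  have hm0 : ∀ t, 0 ≤ m t := fun t => le_max_left _ _
  have hmk : ∀ t, -ε < t → m t ≤ k t := fun t ht => max_le (hk0 t ht).le (by linarith)
  have hmc : ∀ t, -ε < t → m t * (k t - m t) ≤ c * k t := fun t ht => by
    rcases le_total (k t) c with h | h
    · have : m t = 0 := max_eq_left (by linarith)
      rw [this, zero_mul]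
      exact mul_nonneg hc0.le (hk0 t ht).le
    · have : m t = k t - c := max_eq_right (by linarith)
      rw [this]
      nlinarith
  have hm_zero : ∀ t, 1 / 4 ≤ t → m t = 0 := fun t ht => by
    refine max_eq_left ?_
    have h1 : k t ≤ (1 / 4 : ℝ) ^ (-(n / 2 : ℝ)) :=
      Real.rpow_le_rpow_of_nonpos (by norm_num) (by linarith)
        (neg_nonpos.2 (by positivity))
    have h2 : (1 / 4 : ℝ) ^ (-(n / 2 : ℝ)) = c := by
      rw [show (1 / 4 : ℝ) = 2 ^ (-2 : ℝ) by rw [Real.rpow_neg (by norm_num)]; norm_num,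
        ← Real.rpow_mul (by norm_num), hc, ← Real.rpow_natCast]
      congr 1
      ring
    linarith
  have hkc : ContinuousOn k (Ioi (-ε)) := fun t ht => (hkd t ht).continuousAt.continuousWithinAt
  have hmcont : ContinuousOn m (Ioi (-ε)) :=
    (continuous_const.max continuous_id : Continuous fun y : ℝ => max 0 y).comp_continuousOn
      (hkc.sub continuousOn_const)
  have hk'c : ContinuousOn k' (Ioi (-ε)) :=
    continuousOn_const.mul (ContinuousOn.rpow_const (by fun_prop) fun t ht =>
      Or.inl (hσ t ht).ne')
  have hkey : ∀ t, -ε < t → n * (m t ^ 2 / k t) +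
      2 * t * (m t * (2 * k t - m t) / k t ^ 2 * k' t) =
      n * (ε / (t + ε) * (m t * (2 * k t - m t) / k t)) - 2 * n * (m t * (k t - m t) / k t) := by
    intro t ht
    have h1 := (hk0 t ht).ne'
    have h2 := (hσ t ht).ne'
    have h3 : k' t = -(n / 2 : ℝ) * k t / (t + ε) := by
      rw [eq_div_iff h2, mul_comm]; exact hkk' t ht
    rw [h3]
    field_simp
    ring
  have hlow : ∀ t, -ε < t → m t * (k t - m t) / k t ≤ c := fun t ht =>
    (div_le_iff₀ (hk0 t ht)).2 (hmc t ht)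
  have hn : (0 : ℝ) ≤ n := n.cast_nonneg
  refine ⟨fun t => m t ^ 2 / k t, fun t => m t * (2 * k t - m t) / k t ^ 2 * k' t, ?_, ?_, ?_, ?_,
    ?_, ?_, ?_, ?_⟩
  · intro t ht
    have h1 := (hasDerivAt_posPart_sq (k t - c)).comp t ((hkd t ht).sub_const c)
    refine (h1.div (hkd t ht) (hk0 t ht).ne').congr_deriv ?_
    simp only [Function.comp_apply]
    change (2 * m t * k' t * k t - m t ^ 2 * k' t) / k t ^ 2 = _
    ring
  · exact ((hmcont.mul ((continuousOn_const.mul hkc).sub hmcont)).div (hkc.pow 2)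
      fun t ht => pow_ne_zero 2 (hk0 t ht).ne').mul hk'c
  · intro t ht
    exact div_nonneg (sq_nonneg _) (hk0 t (by linarith)).le
  · intro t ht
    have ht' : -ε < t := by linarith
    refine mul_nonpos_of_nonneg_of_nonpos (div_nonneg (mul_nonneg (hm0 t) ?_) (sq_nonneg _)) ?_
    · linarith [hmk t ht', hk0 t ht']
    · exact mul_nonpos_of_nonpos_of_nonneg (neg_nonpos.2 (by positivity))
        (Real.rpow_nonneg (hσ t ht').le _)
  · intro t ht
    simp [hm_zero t ht]
  · intro t ht
    simp [hm_zero t ht]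
  · intro t ht
    have ht' : -ε < t := by linarith
    simp only
    rw [hkey t ht']
    have h1 : 0 ≤ ε / (t + ε) * (m t * (2 * k t - m t) / k t) :=
      mul_nonneg (div_nonneg hε.le (hσ t ht').le) (div_nonneg (mul_nonneg (hm0 t)
        (by linarith [hmk t ht', hk0 t ht'])) (hk0 t ht').le)
    have h2 := mul_le_mul_of_nonneg_left (hlow t ht') hn
    have h3 := mul_nonneg hn h1
    linarith
  · intro t ht hbig
    have ht' : -ε < t := by linarith
    simp only
    rw [hkey t ht']
    have hk2 : 2 * c ≤ k t := hbig
    have hmt : m t = k t - c := max_eq_right (by linarith)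
    have hhalf : k t / 2 ≤ m t * (2 * k t - m t) / k t := by
      rw [le_div_iff₀ (hk0 t ht'), hmt]
      nlinarith
    have h1 : ε / (2 * (t + ε)) * k t ≤ ε / (t + ε) * (m t * (2 * k t - m t) / k t) := by
      have : ε / (2 * (t + ε)) * k t = ε / (t + ε) * (k t / 2) := by
        field_simp
      rw [this]
      exact mul_le_mul_of_nonneg_left hhalf (div_nonneg hε.le (hσ t ht').le)
    have h2 := mul_le_mul_of_nonneg_left (hlow t ht') hn
    have h3 := mul_le_mul_of_nonneg_left h1 hn
    change n * (ε / (2 * (t + ε)) * k t) - 2 * n * c ≤ _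
    linarith

end Weight

section MeanValue
variable {n : ℕ}

local notation "E" => EuclideanSpace ℝ (Fin n)

lemma graphDistSq_le {u : E → ℝ} (hu : Differentiable ℝ u) {Λ : ℝ}
    (hΛ : ∀ x ∈ ball (0 : E) 1, ‖fderiv ℝ u x‖ ≤ Λ) {x : E} (hx : x ∈ ball (0 : E) 1) :
    graphDistSq u x ≤ (1 + Λ ^ 2) * ‖x‖ ^ 2 := by
  have h1 := (convex_ball (0 : E) 1).norm_image_sub_le_of_norm_fderiv_le
    (fun y _ => hu y) hΛ (mem_ball_self one_pos) hx
  rw [sub_zero, Real.norm_eq_abs] at h1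
  have h2 : (u x - u 0) ^ 2 ≤ (Λ * ‖x‖) ^ 2 := by
    rw [← sq_abs (u x - u 0)]
    exact pow_le_pow_left₀ (abs_nonneg _) h1 2
  rw [graphDistSq, ← EuclideanSpace.real_norm_sq_eq]
  linarith [mul_pow Λ ‖x‖ 2]

/-- A mean value inequality for the area element of a minimal graph of bounded slope. -/
lemma exists_areaElement_sub_one_le (hn : 0 < n) (Λ : ℝ) :
    ∃ C : ℝ, 0 ≤ C ∧ ∀ u : E → ℝ, ContDiff ℝ 2 u →
      (∀ x ∈ ball (0 : E) 1, ∑ i, partialDeriv i (graphNormal u i) x = 0) →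
      (∀ x ∈ ball (0 : E) 1, ‖fderiv ℝ u x‖ ≤ Λ) →
      areaElement u 0 - 1 ≤ C * ∫ x in closedBall (0 : E) (1 / 2), (areaElement u x - 1) := by
  set D : ℝ := 2 + Λ ^ 2 with hD
  have hD0 : 0 < D := by positivity
  set κ : ℝ := D ^ (-(n / 2 : ℝ)) with hκ
  have hκ0 : 0 < κ := Real.rpow_pos_of_pos hD0 _
  set ω : ℝ := volume.real (ball (0 : E) 1) with hω
  have hω0 : 0 < ω := ENNReal.toReal_pos (measure_ball_pos _ _ one_pos).ne' measure_ball_lt_top.ne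
  have hnR : (0 : ℝ) < n := by exact_mod_cast hn
  refine ⟨8 * 2 ^ n * D / (κ * ω), by positivity, fun u hu hU hΛ => ?_⟩
  have hgc : Continuous fun x => areaElement u x - 1 :=
    (contDiff_areaElement hu).continuous.sub continuous_const
  have hg0 : ∀ x, 0 ≤ areaElement u x - 1 := fun x => sub_nonneg.2 (one_le_areaElement u x)
  set g : E → ℝ := fun x => areaElement u x - 1 with hg
  change g 0 ≤ _ * ∫ x in closedBall (0 : E) (1 / 2), g x
  set I := ∫ x in closedBall (0 : E) (1 / 2), g x with hI
  have hI0 : 0 ≤ I := integral_nonneg hg0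
  clear_value κ ω I
  rcases (hg0 0).eq_or_lt with h0 | h0
  · exact h0.symm.trans_le (mul_nonneg (by positivity) hI0)
  obtain ⟨δ, hδ, hδg⟩ : ∃ δ > 0, ball (0 : E) δ ⊆ {x | g 0 / 2 < g x} :=
    Metric.mem_nhds_iff.1 ((isOpen_lt continuous_const hgc).mem_nhds (half_lt_self h0))
  obtain ⟨t, ht0, htδ, ht1, htn⟩ : ∃ t : ℝ, 0 < t ∧ t ≤ δ ∧ t ≤ 1 / 2 ∧
      t ^ n ≤ κ / (2 * 2 ^ n) := by
    set b : ℝ := min (κ / (2 * 2 ^ n)) (min δ (1 / 2)) with hb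
    have hb0 : 0 < b := lt_min (by positivity) (lt_min hδ (by norm_num))
    have hb1 : b ≤ 1 / 2 := (min_le_right _ _).trans (min_le_right _ _)
    exact ⟨b, hb0, (min_le_right _ _).trans (min_le_left _ _), hb1,
      (pow_le_of_le_one hb0.le (by linarith) hn.ne').trans (min_le_left _ _)⟩
  have htn0 : 0 < t ^ n := pow_pos ht0 n
  obtain ⟨h, h', hd, hc, hpos, hneg, hz, hz', hlow, hbig⟩ := exists_weight n (pow_pos ht0 2)
  have hmain := integral_tilt_mul_weight_nonpos hu hU (pow_pos ht0 2) hd hc hpos hneg hz hz'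
  simp only [tilt_mul_areaElement] at hmain
  set φ : ℝ → ℝ := fun s => n * h s + 2 * s * h' s with hφ
  have hφz : ∀ s, 1 / 4 ≤ s → φ s = 0 := fun s hs => by simp [hφ, hz s hs, hz' s hs]
  have hφc : ContinuousOn φ (Ioi (-t ^ 2)) :=
    (continuousOn_const.mul fun s hs => (hd s hs).continuousAt.continuousWithinAt).add
      ((continuousOn_const.mul continuousOn_id).mul hc)
  change ∫ x, g x * φ (graphDistSq u x) ≤ 0 at hmain
  have hsc : Continuous fun x => φ (graphDistSq u x) :=
    hφc.comp_continuous (contDiff_graphDistSq hu).continuous fun x =>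
      lt_of_lt_of_le (neg_lt_zero.2 (pow_pos ht0 2)) (graphDistSq_nonneg u x)
  have hInt : Integrable fun x => g x * φ (graphDistSq u x) :=
    (hgc.mul hsc).integrable_of_hasCompactSupport
      (hasCompactSupport_comp_graphDistSq u hφz).mul_left
  set a : ℝ := n * (1 / (2 * D) * (κ / t ^ n)) with ha
  set B : ℝ := 2 * n * 2 ^ n with hB
  have ha0 : 0 < a := by positivity
  have hgcB : IntegrableOn g (closedBall (0 : E) (1 / 2)) :=
    hgc.continuousOn.integrableOn_compact (isCompact_closedBall _ _)
  have hsub : ball (0 : E) t ⊆ closedBall (0 : E) (1 / 2) :=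
    ball_subset_closedBall.trans (closedBall_subset_closedBall ht1)
  have hgb : IntegrableOn g (ball (0 : E) t) := hgcB.mono_set hsub
  have hInt1 := (integrable_indicator_iff measurableSet_ball).2 (hgb.const_mul a)
  have hInt2 := (integrable_indicator_iff measurableSet_closedBall).2 (hgcB.const_mul B)
  have hpt : ∀ x, (ball (0 : E) t).indicator (fun x => a * g x) x -
      (closedBall (0 : E) (1 / 2)).indicator (fun x => B * g x) x ≤
        g x * φ (graphDistSq u x) := by
    intro x
    have hs0 := graphDistSq_nonneg u x
    by_cases hx : x ∈ ball (0 : E) t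
    · rw [indicator_of_mem hx, indicator_of_mem (hsub hx)]
      have hxt : ‖x‖ < t := mem_ball_zero_iff.1 hx
      have hs := graphDistSq_le (hu.differentiable two_ne_zero) hΛ
        (mem_ball_zero_iff.2 (by linarith) : x ∈ ball (0 : E) 1)
      have hsD : graphDistSq u x + t ^ 2 ≤ D * t ^ 2 := by
        have : (1 + Λ ^ 2) * ‖x‖ ^ 2 ≤ (1 + Λ ^ 2) * t ^ 2 := by gcongr
        rw [hD]
        linarith
      have hst : 0 < graphDistSq u x + t ^ 2 := by positivity
      have hDt : (D * t ^ 2) ^ (-(n / 2 : ℝ)) = κ / t ^ n := by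
        rw [Real.mul_rpow hD0.le (sq_nonneg t), ← hκ, ← Real.rpow_natCast t 2,
          ← Real.rpow_mul ht0.le, show ((2 : ℕ) : ℝ) * -(n / 2 : ℝ) = -(n : ℝ) by push_cast; ring,
          Real.rpow_neg ht0.le, Real.rpow_natCast, div_eq_mul_inv]
      have hk : κ / t ^ n ≤ (graphDistSq u x + t ^ 2) ^ (-(n / 2 : ℝ)) := by
        rw [← hDt]
        exact Real.rpow_le_rpow_of_nonpos hst hsD (neg_nonpos.2 (by positivity))
      have h2 : 2 * 2 ^ n ≤ κ / t ^ n := by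
        rw [le_div_iff₀ htn0, mul_comm]
        exact (le_div_iff₀ (by positivity)).1 htn
      have h3 := hbig _ hs0 (h2.trans hk)
      have h4 : 1 / (2 * D) ≤ t ^ 2 / (2 * (graphDistSq u x + t ^ 2)) := by
        rw [div_le_div_iff₀ (by positivity) (by positivity)]
        linarith
      have h5 : a - B ≤ φ (graphDistSq u x) := by
        refine le_trans ?_ h3
        rw [ha, hB]
        gcongr
      have := mul_le_mul_of_nonneg_left h5 (hg0 x)
      change g x * (a - B) ≤ _ at this
      linarith
    · rw [indicator_of_notMem hx]
      by_cases hx' : x ∈ closedBall (0 : E) (1 / 2)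
      · rw [indicator_of_mem hx']
        have := mul_le_mul_of_nonneg_left (hlow _ hs0) (hg0 x)
        change g x * (-B) ≤ g x * φ (graphDistSq u x) at this
        linarith
      · rw [indicator_of_notMem hx', hφz _ ?_]
        · simp
        · rw [mem_closedBall_zero_iff, not_le] at hx'
          nlinarith [norm_sq_le_graphDistSq u x]
  have hle := (integral_mono (hInt1.sub hInt2) hInt hpt).trans hmain
  simp only [Pi.sub_apply] at hle
  rw [integral_sub hInt1 hInt2, integral_indicator measurableSet_ball,
    integral_indicator measurableSet_closedBall, integral_const_mul, integral_const_mul,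
    ← hI] at hle
  have hvol : volume.real (ball (0 : E) t) = t ^ n * ω := by
    rw [hω, measureReal_def, measureReal_def, Measure.addHaar_ball_of_pos _ _ ht0,
      ENNReal.toReal_mul, ENNReal.toReal_ofReal (by positivity), finrank_euclideanSpace_fin]
  have hlb : g 0 / 2 * (t ^ n * ω) ≤ ∫ x in ball (0 : E) t, g x := by
    rw [← hvol]
    have : ∫ _ in ball (0 : E) t, g 0 / 2 ≤ ∫ x in ball (0 : E) t, g x :=
      setIntegral_mono_on (integrableOn_const measure_ball_lt_top.ne) hgb measurableSet_ball
        fun x hx => (hδg (ball_subset_ball htδ hx)).le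
    rwa [setIntegral_const, smul_eq_mul, mul_comm] at this
  have hfin : a * (g 0 / 2 * (t ^ n * ω)) ≤ B * I := by
    have := mul_le_mul_of_nonneg_left hlb ha0.le
    linarith
  have ha' : a * (g 0 / 2 * (t ^ n * ω)) = n * (g 0 * (κ * ω)) / (4 * D) := by
    rw [ha]
    field_simp
    ring
  rw [ha', div_le_iff₀ (by positivity), hB] at hfin
  rw [div_mul_eq_mul_div, le_div_iff₀ (by positivity)]
  refine le_of_mul_le_mul_left (hfin.trans_eq ?_) hnR
  ring

/-- Interior gradient estimate at the centre of the unit ball. -/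
lemma exists_norm_fderiv_zero_sq_le (hn : 0 < n) (Λ : ℝ) :
    ∃ C : ℝ, ∀ u : E → ℝ, ContDiff ℝ 2 u →
      (∀ x ∈ ball (0 : E) 1, ∑ i, partialDeriv i (graphNormal u i) x = 0) →
      (∀ x ∈ ball (0 : E) 1, ‖fderiv ℝ u x‖ ≤ Λ) →
      ‖fderiv ℝ u 0‖ ^ 2 ≤ C * ∫ x in ball (0 : E) 1, u x ^ 2 := by
  obtain ⟨C₁, hC₁, h₁⟩ := exists_areaElement_sub_one_le hn Λ
  obtain ⟨C₂, -, h₂⟩ := exists_integral_areaElement_sub_one_le (n := n)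
  refine ⟨(2 + |Λ|) * (C₁ * C₂), fun u hu hU hΛ => ?_⟩
  have h3 := (h₁ u hu hU hΛ).trans (mul_le_mul_of_nonneg_left (h₂ u hu hU) hC₁)
  have hW := areaElement_sq u 0
  have hW1 := one_le_areaElement u (0 : E)
  have hΛ0 : ‖fderiv ℝ u 0‖ ≤ |Λ| := (hΛ 0 (mem_ball_self one_pos)).trans (le_abs_self Λ)
  have hWΛ : areaElement u 0 ≤ 1 + |Λ| := by
    refine abs_le_of_sq_le_sq' ?_ (by positivity) |>.2
    have : ‖fderiv ℝ u 0‖ ^ 2 ≤ |Λ| ^ 2 := by gcongr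
    nlinarith [abs_nonneg Λ]
  calc ‖fderiv ℝ u 0‖ ^ 2 = (areaElement u 0 + 1) * (areaElement u 0 - 1) := by
        linear_combination -hW
    _ ≤ (2 + |Λ|) * (areaElement u 0 - 1) :=
        mul_le_mul_of_nonneg_right (by linarith) (by linarith)
    _ ≤ (2 + |Λ|) * (C₁ * (C₂ * ∫ x in ball (0 : E) 1, u x ^ 2)) :=
        mul_le_mul_of_nonneg_left h3 (by positivity)
    _ = _ := by ring

end MeanValue

section Rescaling
variable {n : ℕ}

local notation "E" => EuclideanSpace ℝ (Fin n)

lemma fderiv_comp_add_const_smul (f : E → ℝ) (x : E) (r : ℝ) (z : E) :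
    fderiv ℝ (fun z => f (x + r • z)) z = r • fderiv ℝ f (x + r • z) := by
  rw [fderiv_comp_smul (f := fun w => f (x + w)), fderiv_comp_add_left]

/-- A function that is `C²` near a ball agrees, after rescaling that ball to the unit ball, with a
globally `C²` function. -/
lemma exists_contDiff_eventuallyEq_rescale {u : E → ℝ} {x : E} {r : ℝ} (hr : 0 < r)
    (hu : ContDiffOn ℝ 2 u (ball x (2 * r))) :
    ∃ v : E → ℝ, ContDiff ℝ 2 v ∧
      ∀ z ∈ ball (0 : E) 1, v =ᶠ[nhds z] fun z => r⁻¹ • u (x + r • z) := by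
  let χ : ContDiffBump x := ⟨r, 3 / 2 * r, hr, by linarith⟩
  have hχs : tsupport χ ⊆ ball x (2 * r) := by
    rw [χ.tsupport_eq]
    exact closedBall_subset_ball (by change 3 / 2 * r < 2 * r; linarith)
  have hχu : ContDiff ℝ 2 fun y => χ y * u y := by
    refine contDiff_iff_contDiffAt.2 fun y => ?_
    by_cases hy : y ∈ tsupport fun y => χ y * u y
    · exact χ.contDiff.contDiffAt.mul
        (hu.contDiffAt (isOpen_ball.mem_nhds (hχs (tsupport_mul_subset_left hy))))
    · exact contDiffAt_const.congr_of_eventuallyEq (notMem_tsupport_iff_eventuallyEq.1 hy)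
  have haff : ContDiff ℝ 2 fun z : E => x + r • z := by fun_prop
  refine ⟨fun z => r⁻¹ • (χ (x + r • z) * u (x + r • z)), (hχu.comp haff).const_smul r⁻¹,
    fun z hz => ?_⟩
  have hmem : x + r • z ∈ ball x r := by
    rw [mem_ball_iff_norm, add_sub_cancel_left, norm_smul, Real.norm_of_nonneg hr.le]
    have := mem_ball_zero_iff.1 hz
    nlinarith
  have h1 := haff.continuous.continuousAt.eventually (χ.eventuallyEq_one_of_mem_ball hmem)
  filter_upwards [h1] with w hw
  rw [hw, Pi.one_apply, one_mul]

lemma setIntegral_ball_rescale (f : E → ℝ) (x : E) {r : ℝ} (hr : 0 < r) :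
    ∫ z in ball (0 : E) 1, f (x + r • z) = (r ^ n)⁻¹ * ∫ z in ball x r, f z := by
  rw [Measure.setIntegral_comp_smul_of_pos volume (fun w => f (x + w)) _ hr,
    finrank_euclideanSpace_fin, smul_unitBall_of_pos hr, smul_eq_mul]
  congr 1
  have := (measurePreserving_add_left volume x).setIntegral_preimage_emb
    (measurableEmbedding_addLeft x) f (ball x r)
  rw [← this]
  congr 2
  ext w
  simp

/-- Interior gradient estimate at the centre of a ball. -/
lemma exists_norm_fderiv_sq_le (hn : 0 < n) (Λ : ℝ) :
    ∃ C : ℝ, 0 ≤ C ∧ ∀ (u : E → ℝ) (x : E) (r : ℝ), 0 < r → ContDiffOn ℝ 2 u (ball x (2 * r)) →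
      (∀ y ∈ ball x r, ∑ i, partialDeriv i (graphNormal u i) y = 0) →
      (∀ y ∈ ball x r, ‖fderiv ℝ u y‖ ≤ Λ) →
      ‖fderiv ℝ u x‖ ^ 2 ≤ C / r ^ (n + 2) * ∫ z in ball x r, u z ^ 2 := by
  obtain ⟨C, hC⟩ := exists_norm_fderiv_zero_sq_le hn Λ
  refine ⟨|C|, abs_nonneg C, fun u x r hr hu hU hΛ => ?_⟩
  obtain ⟨v, hv, hvu⟩ := exists_contDiff_eventuallyEq_rescale hr hu
  have hmem : ∀ z ∈ ball (0 : E) 1, x + r • z ∈ ball x r := fun z hz => by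
    rw [mem_ball_iff_norm, add_sub_cancel_left, norm_smul, Real.norm_of_nonneg hr.le]
    have := mem_ball_zero_iff.1 hz
    nlinarith
  have hD : ∀ z ∈ ball (0 : E) 1, fderiv ℝ v z = fderiv ℝ u (x + r • z) := fun z hz => by
    have h := congrFun (fderiv_const_smul_field (𝕜 := ℝ) (f := fun z => u (x + r • z)) r⁻¹) z
    rw [Pi.smul_apply, fderiv_comp_add_const_smul, smul_smul, inv_mul_cancel₀ hr.ne',
      one_smul] at h
    exact (hvu z hz).fderiv_eq.trans h
  have hvU : ∀ z ∈ ball (0 : E) 1, ∑ i, partialDeriv i (graphNormal v i) z = 0 := fun z hz => by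
    have h1 : ∀ i, partialDeriv i (graphNormal v i) z =
        r * partialDeriv i (graphNormal u i) (x + r • z) := fun i => by
      have h2 : graphNormal v i =ᶠ[nhds z] fun z => graphNormal u i (x + r • z) := by
        filter_upwards [isOpen_ball.mem_nhds hz] with w hw
        rw [graphNormal, graphNormal, areaElement, areaElement, partialDeriv, partialDeriv,
          hD w hw]
      rw [partialDeriv, h2.fderiv_eq, fderiv_comp_add_const_smul]
      rfl
    simp only [h1]
    rw [← Finset.mul_sum, hU _ (hmem z hz), mul_zero]
  have h0 := hC v hv hvU fun z hz => (hD z hz).symm ▸ hΛ _ (hmem z hz)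
  rw [hD 0 (mem_ball_self one_pos), smul_zero, add_zero] at h0
  have hInt : ∫ z in ball (0 : E) 1, v z ^ 2 = 1 / r ^ (n + 2) * ∫ z in ball x r, u z ^ 2 := by
    have h1 : ∫ z in ball (0 : E) 1, v z ^ 2 =
        ∫ z in ball (0 : E) 1, (r ^ 2)⁻¹ * u (x + r • z) ^ 2 :=
      setIntegral_congr_fun measurableSet_ball fun z hz => by
        simp only [(hvu z hz).eq_of_nhds, smul_eq_mul, mul_pow, inv_pow]
    rw [h1, integral_const_mul, setIntegral_ball_rescale (fun y => u y ^ 2) x hr, ← mul_assoc,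
      ← mul_inv, ← pow_add, add_comm 2 n, one_div]
  rw [hInt] at h0
  refine h0.trans ?_
  have h2 : 0 ≤ 1 / r ^ (n + 2) * ∫ z in ball x r, u z ^ 2 :=
    mul_nonneg (by positivity) (integral_nonneg fun z => sq_nonneg _)
  calc C * (1 / r ^ (n + 2) * ∫ z in ball x r, u z ^ 2)
      ≤ |C| * (1 / r ^ (n + 2) * ∫ z in ball x r, u z ^ 2) :=
        mul_le_mul_of_nonneg_right (le_abs_self C) h2
    _ = _ := by ring

end Rescaling

/-- Interior gradient estimate for solutions of the minimal surface equation with a priori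
bounded gradient: there is `c = c(n, Λ)` such that any `C²` solution `u` of
`div(Du/√(1+|Du|²)) = 0` on an open `Ω` with `|u| ≤ K`, `|Du| ≤ Λ` on `Ω` satisfies
`sup_{B_{ρ/2}(y)} |Du|² ≤ (c/ρ^{n+2}) ∫_{B_ρ(y)} u²` whenever `B_ρ(y) ⊆ Ω`. -/
theorem stmt_16 (n : ℕ) (hn : 2 ≤ n) (Λ : ℝ) :
    ∃ c : ℝ, ∀ (Ω : Set (EuclideanSpace ℝ (Fin n))), IsOpen Ω →
      ∀ u : EuclideanSpace ℝ (Fin n) → ℝ, ContDiffOn ℝ 2 u Ω →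
      (∀ x ∈ Ω, (∑ i : Fin n, fderiv ℝ
          (fun y => fderiv ℝ u y (EuclideanSpace.single i 1) /
            Real.sqrt (1 + ‖fderiv ℝ u y‖ ^ 2)) x (EuclideanSpace.single i 1)) = 0) →
      ∀ K : ℝ, (∀ x ∈ Ω, |u x| ≤ K) → (∀ x ∈ Ω, ‖fderiv ℝ u x‖ ≤ Λ) →
      ∀ (y : EuclideanSpace ℝ (Fin n)) (ρ : ℝ), 0 < ρ → ball y ρ ⊆ Ω →
      ∀ x ∈ ball y (ρ / 2),
        ‖fderiv ℝ u x‖ ^ 2 ≤ c / ρ ^ (n + 2) * ∫ z in ball y ρ, (u z) ^ 2 := by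
  obtain ⟨C, hC, h⟩ := exists_norm_fderiv_sq_le (n := n) (by omega) Λ
  refine ⟨C * 4 ^ (n + 2), fun Ω hΩ u hu hU K hK hΛ y ρ hρ hball x hx => ?_⟩
  have hsub : ball x (ρ / 2) ⊆ ball y ρ := ball_subset_ball' (by linarith [mem_ball.1 hx])
  have hsub' : ball x (ρ / 4) ⊆ ball y ρ := (ball_subset_ball (by linarith)).trans hsub
  have hest := h u x (ρ / 4) (by linarith)
    (hu.mono (by rw [show 2 * (ρ / 4) = ρ / 2 by ring]; exact hsub.trans hball))
    (fun z hz => hU z (hball (hsub' hz))) fun z hz => hΛ z (hball (hsub' hz))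
  have hcont : ContinuousOn (fun z => u z ^ 2) (ball y ρ) := (hu.continuousOn.mono hball).pow 2
  have hInt : IntegrableOn (fun z => u z ^ 2) (ball y ρ) := by
    refine IntegrableOn.of_bound measure_ball_lt_top
      (hcont.aestronglyMeasurable measurableSet_ball) (K ^ 2) ?_
    refine (ae_restrict_iff' measurableSet_ball).2 (Filter.Eventually.of_forall fun z hz => ?_)
    rw [Real.norm_of_nonneg (sq_nonneg _), ← sq_abs]
    exact pow_le_pow_left₀ (abs_nonneg _) (hK z (hball hz)) 2
  have hmono : ∫ z in ball x (ρ / 4), u z ^ 2 ≤ ∫ z in ball y ρ, u z ^ 2 :=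
    setIntegral_mono_set hInt (Filter.Eventually.of_forall fun z => sq_nonneg _)
      hsub'.eventuallyLE
  calc ‖fderiv ℝ u x‖ ^ 2 ≤ C / (ρ / 4) ^ (n + 2) * ∫ z in ball x (ρ / 4), u z ^ 2 := hest
    _ ≤ C / (ρ / 4) ^ (n + 2) * ∫ z in ball y ρ, u z ^ 2 :=
        mul_le_mul_of_nonneg_left hmono (by positivity)
    _ = _ := by rw [div_pow, div_div_eq_mul_div]
end
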